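/- arXiv:2107.04056 — 6 statements merged into one kernel-verified Lean document; each statement's English description precedes it below -/
import Mathlib

section
/- Consider a strongly connected weighted digraph on N ≥ 2 nodes with weights a and Laplacian L, and local cost functions c₁,…,c_N satisfying Assumption 1. Let s* ∈ ℝ be the unique minimizer of the global cost c(s) = ∑_{i=1}^N c_i(s). Then there exist constants β₁ > 0 and β₂ > 0 with the following property: for any differentiable matrix-valued function Ξ : [0,∞) → ℝ^{N×N} satisfying Ξ'(t) = −L·Ξ(t) for all t ≥ 0 and Ξ(0) = I_N, and any differentiable functions y^r, z : [0,∞) → ℝ^N satisfying z(0) = 0 and, for all t ≥ 0 and each i, (y_i^r)'(t) = −(1/Ξ(t)_{ii})·c_i'(y_i^r(t)) − β₁·∑_{j=1}^N a_{ij}(y_i^r(t) − y_j^r(t)) − β₂·z_i(t) and z_i'(t) = β₁·∑_{j=1}^N a_{ij}(y_i^r(t) − y_j^r(t)), one has: (a) Ξ(t)_{ii} > 0 for all t ≥ 0 and all i (so the equations are well defined); (b) y^r is bounded on [0,∞); and (c) there exist constants C ≥ 0 and μ > 0 such that ‖y^r(t) − s*·𝟏_N‖ ≤ C·e^{−μt}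 for all t ≥ 0, i.e., every y_i^r(t) converges exponentially to the optimal solution s*. -/
open Matrix

/-- The Laplacian of a strongly connected weighted digraph has a positive left null vector,
normalised to have unit sum. -/
lemma exists_pos_balancing_weights {n : Type*} [Fintype n] [DecidableEq n] [Nonempty n]
    {a : n → n → ℝ} (ha : ∀ i j, 0 ≤ a i j)
    (hconn : ∀ i j : n, i ≠ j → Relation.TransGen (fun p q : n => 0 < a q p) i j) :
    ∃ ξ : n → ℝ, (∀ i, 0 < ξ i) ∧ ∑ i, ξ i = 1 ∧
      ∀ j, ∑ i, ξ i * a i j = ξ j * ∑ k, a j k := by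
  set M : Matrix n n ℝ := diagonal (fun i => ∑ k, a i k) - of a with hM
  have hdet : M.det = 0 := by
    rw [← exists_mulVec_eq_zero_iff]
    refine ⟨1, one_ne_zero, ?_⟩
    ext i
    simp [hM, mulVec, dotProduct, diagonal_apply]
  obtain ⟨v, hv0, hv⟩ := exists_vecMul_eq_zero_iff.mpr hdet
  have hv' : ∀ j, ∑ i, v i * a i j = v j * ∑ k, a j k := by
    intro j
    have := congrFun hv j
    simp only [hM, vecMul_sub, vecMul_diagonal, Pi.sub_apply, Pi.zero_apply] at this
    simp only [vecMul, dotProduct, of_apply] at this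
    linarith
  have hle : ∀ j ∈ Finset.univ, |v j| * ∑ k, a j k ≤ ∑ i, |v i| * a i j := by
    intro j _
    have hd : 0 ≤ ∑ k, a j k := Finset.sum_nonneg fun k _ => ha j k
    calc |v j| * ∑ k, a j k = |∑ i, v i * a i j| := by rw [hv', abs_mul, abs_of_nonneg hd]
      _ ≤ ∑ i, |v i * a i j| := Finset.abs_sum_le_sum_abs _ _
      _ = ∑ i, |v i| * a i j := by
        refine Finset.sum_congr rfl fun i _ => ?_
        rw [abs_mul, abs_of_nonneg (ha i j)]
  have hsum : ∑ j, |v j| * ∑ k, a j k = ∑ j, ∑ i, |v i| * a i j := by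
    rw [Finset.sum_comm]
    simp only [Finset.mul_sum]
  have heq := (Finset.sum_eq_sum_iff_of_le hle).mp hsum
  have hstep : ∀ p q, 0 < a q p → v p = 0 → v q = 0 := by
    intro p q hpq hp
    have h := heq p (Finset.mem_univ p)
    rw [hp, abs_zero, zero_mul, eq_comm,
      Finset.sum_eq_zero_iff_of_nonneg fun i _ => mul_nonneg (abs_nonneg _) (ha i p)] at h
    simpa [hpq.ne'] using h q (Finset.mem_univ q)
  have hne : ∀ i, v i ≠ 0 := by
    intro i hi
    refine hv0 (funext fun j => ?_)
    rcases eq_or_ne i j with rfl | hij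
    · exact hi
    · have key : ∀ q, Relation.TransGen (fun p q : n => 0 < a q p) i q → v q = 0 := by
        intro q hq
        induction hq with
        | single h => exact hstep _ _ h hi
        | tail _ h ih => exact hstep _ _ h ih
      exact key j (hconn i j hij)
  have hpos : 0 < ∑ i, |v i| :=
    Finset.sum_pos (fun i _ => abs_pos.mpr (hne i)) Finset.univ_nonempty
  refine ⟨fun i => |v i| / ∑ k, |v k|, fun i => div_pos (abs_pos.mpr (hne i)) hpos, ?_, ?_⟩
  · rw [← Finset.sum_div, div_self hpos.ne']
  · intro j
    simp only [div_mul_eq_mul_div, ← Finset.sum_div]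
    rw [heq j (Finset.mem_univ j)]

lemma sum_balanced_sub_eq_zero {n : Type*} [Fintype n] {a : n → n → ℝ} {ξ : n → ℝ}
    (hbal : ∀ j, ∑ i, ξ i * a i j = ξ j * ∑ k, a j k) (f : n → ℝ) :
    ∑ i, ∑ j, ξ i * a i j * (f i - f j) = 0 := by
  simp only [mul_sub, Finset.sum_sub_distrib]
  rw [sub_eq_zero]
  conv_rhs => rw [Finset.sum_comm]
  simp only [← Finset.sum_mul]
  simp only [hbal, ← Finset.mul_sum]

lemma sum_mul_laplacian_eq_zero {n : Type*} [Fintype n] {a : n → n → ℝ} {ξ : n → ℝ}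
    (hbal : ∀ j, ∑ i, ξ i * a i j = ξ j * ∑ k, a j k) (x : n → ℝ) :
    ∑ i, ξ i * ∑ j, a i j * (x i - x j) = 0 := by
  rw [← sum_balanced_sub_eq_zero hbal x]
  simp only [Finset.mul_sum, mul_assoc]

/-- The quadratic form of the weighted Laplacian is half the Dirichlet energy. -/
lemma two_mul_sum_mul_laplacian {n : Type*} [Fintype n] {a : n → n → ℝ} {ξ : n → ℝ}
    (hbal : ∀ j, ∑ i, ξ i * a i j = ξ j * ∑ k, a j k) (x : n → ℝ) :
    2 * ∑ i, ξ i * (x i * ∑ j, a i j * (x i - x j)) =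
      ∑ i, ∑ j, ξ i * a i j * (x i - x j) ^ 2 := by
  rw [← sub_eq_zero, ← sum_balanced_sub_eq_zero hbal fun i => x i ^ 2]
  simp only [Finset.mul_sum, ← Finset.sum_sub_distrib]
  exact Finset.sum_congr rfl fun i _ => Finset.sum_congr rfl fun j _ => by ring

/-- Spectral gap: the Dirichlet energy of a strongly connected digraph controls all the
differences of node values. -/
lemma exists_dirichlet_gap {n : Type*} [Fintype n] {a : n → n → ℝ} {ξ : n → ℝ}
    (ha : ∀ i j, 0 ≤ a i j)
    (hconn : ∀ i j : n, i ≠ j → Relation.TransGen (fun p q : n => 0 < a q p) i j)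
    (hξ : ∀ i, 0 < ξ i) :
    ∃ lam : ℝ, 0 < lam ∧ ∀ (x : n → ℝ) (i j : n),
      lam * (x i - x j) ^ 2 ≤ ∑ i, ∑ j, ξ i * a i j * (x i - x j) ^ 2 := by
  set E : (n → ℝ) → ℝ := fun x => ∑ i, ∑ j, ξ i * a i j * (x i - x j) ^ 2 with hE
  have hterm : ∀ (x : n → ℝ) i j, 0 ≤ ξ i * a i j * (x i - x j) ^ 2 := fun x i j =>
    mul_nonneg (mul_nonneg (hξ i).le (ha i j)) (sq_nonneg _)
  have hE0 : ∀ x, 0 ≤ E x := fun x =>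
    Finset.sum_nonneg fun i _ => Finset.sum_nonneg fun j _ => hterm x i j
  have hedge : ∀ p q, 0 < a q p → ∀ x : n → ℝ, (x p - x q) ^ 2 ≤ (ξ q * a q p)⁻¹ * E x := by
    intro p q hpq x
    rw [inv_mul_eq_div, le_div_iff₀ (mul_pos (hξ q) hpq)]
    calc (x p - x q) ^ 2 * (ξ q * a q p) = ξ q * a q p * (x q - x p) ^ 2 := by ring
      _ ≤ ∑ j, ξ q * a q j * (x q - x j) ^ 2 :=
        Finset.single_le_sum (f := fun j => ξ q * a q j * (x q - x j) ^ 2)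
          (fun j _ => hterm x q j) (Finset.mem_univ p)
      _ ≤ E x := Finset.single_le_sum (f := fun i => ∑ j, ξ i * a i j * (x i - x j) ^ 2)
          (fun i _ => Finset.sum_nonneg fun j _ => hterm x i j) (Finset.mem_univ q)
  have hpath : ∀ i j, Relation.TransGen (fun p q : n => 0 < a q p) i j →
      ∃ K : ℝ, 0 ≤ K ∧ ∀ x : n → ℝ, (x i - x j) ^ 2 ≤ K * E x := by
    intro i j hij
    induction hij with
    | single h => exact ⟨_, inv_nonneg.mpr (mul_pos (hξ _) h).le, hedge _ _ h⟩
    | @tail p q _ h ih =>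
      obtain ⟨K, hK, hKx⟩ := ih
      refine ⟨2 * K + 2 * (ξ q * a q p)⁻¹, ?_, fun x => ?_⟩
      · have := inv_nonneg.mpr (mul_pos (hξ q) h).le
        positivity
      · nlinarith [hKx x, hedge _ _ h x, sq_nonneg ((x i - x p) - (x p - x q))]
  have hall : ∀ i j, ∃ K : ℝ, 0 ≤ K ∧ ∀ x : n → ℝ, (x i - x j) ^ 2 ≤ K * E x := by
    intro i j
    rcases eq_or_ne i j with rfl | hij
    · exact ⟨0, le_rfl, by simp⟩
    · exact hpath i j (hconn i j hij)
  choose K hK hKx using hall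
  have hS : 0 ≤ ∑ i, ∑ j, K i j :=
    Finset.sum_nonneg fun i _ => Finset.sum_nonneg fun j _ => hK i j
  have hKS : ∀ i j, K i j ≤ ∑ i, ∑ j, K i j := fun i j =>
    (Finset.single_le_sum (f := fun j => K i j) (fun j _ => hK i j) (Finset.mem_univ j)).trans
      (Finset.single_le_sum (f := fun i => ∑ j, K i j)
        (fun i _ => Finset.sum_nonneg fun j _ => hK i j) (Finset.mem_univ i))
  refine ⟨(∑ i, ∑ j, K i j + 1)⁻¹, by positivity, fun x i j => ?_⟩
  rw [inv_mul_eq_div, div_le_iff₀ (by positivity)]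
  nlinarith [hKx i j x, mul_le_mul_of_nonneg_right (hKS i j) (hE0 x), hE0 x]

lemma le_initial_of_hasDerivAt_nonpos {f f' : ℝ → ℝ}
    (hf : ∀ t, 0 ≤ t → HasDerivAt f (f' t) t) (hf' : ∀ t, 0 ≤ t → f' t ≤ 0)
    {t : ℝ} (ht : 0 ≤ t) : f t ≤ f 0 := by
  refine antitoneOn_of_deriv_nonpos (convex_Ici (0 : ℝ))
    (fun s hs => (hf s hs).continuousAt.continuousWithinAt)
    (fun s hs => (hf s (interior_subset hs)).differentiableAt.differentiableWithinAt)
    (fun s hs => ?_) (Set.mem_Ici.mpr le_rfl) ht ht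
  rw [(hf s (interior_subset hs)).deriv]
  exact hf' s (interior_subset hs)

lemma le_mul_exp_of_hasDerivAt_le {f f' : ℝ → ℝ} {r : ℝ}
    (hf : ∀ t, 0 ≤ t → HasDerivAt f (f' t) t) (hf' : ∀ t, 0 ≤ t → f' t ≤ -r * f t)
    {t : ℝ} (ht : 0 ≤ t) : f t ≤ f 0 * Real.exp (-r * t) := by
  have hexp : ∀ s, HasDerivAt (fun s => Real.exp (r * s)) (Real.exp (r * s) * r) s := fun s => by
    simpa using ((hasDerivAt_id s).const_mul r).exp
  have h := le_initial_of_hasDerivAt_nonpos (f := fun s => f s * Real.exp (r * s))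
    (fun s hs => (hf s hs).mul (hexp s))
    (fun s hs => by
      have := mul_le_mul_of_nonneg_right (hf' s hs) (Real.exp_pos (r * s)).le
      nlinarith) ht
  simp only [mul_zero, Real.exp_zero, mul_one] at h
  rw [neg_mul, Real.exp_neg, ← div_eq_mul_inv, le_div_iff₀ (Real.exp_pos _)]
  exact h

/-- A differential inequality with exponentially vanishing perturbation forces exponential
decay. -/
lemma exists_exp_bound_of_perturbed_decay {V V' : ℝ → ℝ} {ρ α M : ℝ}
    (hρ : 0 < ρ) (hα : 0 < α) (hM : 0 ≤ M)
    (hV : ∀ t, 0 ≤ t → HasDerivAt V (V' t) t) (hV0 : ∀ t, 0 ≤ t → 0 ≤ V t)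
    (hV' : ∀ t, 0 ≤ t → V' t ≤ -ρ * V t + M * Real.exp (-α * t) * (V t + 1)) :
    ∃ C μ : ℝ, 0 ≤ C ∧ 0 < μ ∧ ∀ t, 0 ≤ t → V t ≤ C * Real.exp (-μ * t) := by
  set μ := min ρ (α / 2) with hμ
  have hμρ : μ ≤ ρ := min_le_left _ _
  have hμα : μ ≤ α / 2 := min_le_right _ _
  have hμ0 : 0 < μ := lt_min hρ (half_pos hα)
  set φ : ℝ → ℝ := fun t => μ * t + M / α * Real.exp (-α * t) with hφ
  set K := 2 * M * Real.exp (M / α) / α with hK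
  have hK0 : 0 ≤ K := by positivity
  have hexp : ∀ r s : ℝ, HasDerivAt (fun s => Real.exp (r * s)) (Real.exp (r * s) * r) s :=
    fun r s => by simpa using ((hasDerivAt_id s).const_mul r).exp
  have hφ' : ∀ s, HasDerivAt φ (μ - M * Real.exp (-α * s)) s := fun s => by
    refine (((hasDerivAt_id s).const_mul μ).add ((hexp (-α) s).const_mul (M / α))).congr_deriv ?_
    field_simp
    ring
  have hφle : ∀ s, 0 ≤ s → φ s ≤ μ * s + M / α := fun s hs => by
    have h1 : Real.exp (-α * s) ≤ 1 := Real.exp_le_one_iff.mpr (by nlinarith)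
    have h2 : 0 ≤ M / α := by positivity
    simp only [hφ]
    nlinarith
  have h := fun t (ht : 0 ≤ t) => le_initial_of_hasDerivAt_nonpos
    (f := fun s => V s * Real.exp (φ s) + K * Real.exp (-(α / 2) * s))
    (fun s hs => ((hV s hs).mul (hφ' s).exp).add ((hexp (-(α / 2)) s).const_mul K))
    (fun s hs => by
      have h1 : V' s + V s * (μ - M * Real.exp (-α * s)) ≤ M * Real.exp (-α * s) := by
        nlinarith [hV' s hs, hV0 s hs, mul_le_mul_of_nonneg_right hμρ (hV0 s hs)]
      have h2 : Real.exp (-α * s) * Real.exp (φ s) ≤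
          Real.exp (M / α) * Real.exp (-(α / 2) * s) := by
        rw [← Real.exp_add, ← Real.exp_add]
        refine Real.exp_le_exp.mpr ?_
        nlinarith [hφle s hs]
      have h3 : K * (Real.exp (-(α / 2) * s) * -(α / 2)) =
          -(M * (Real.exp (M / α) * Real.exp (-(α / 2) * s))) := by
        simp only [hK]
        field_simp
      rw [h3]
      nlinarith [mul_le_mul_of_nonneg_right h1 (Real.exp_pos (φ s)).le,
        mul_le_mul_of_nonneg_left h2 hM]) ht
  refine ⟨V 0 * Real.exp (φ 0) + K, μ, add_nonneg (mul_nonneg (hV0 0 le_rfl) (Real.exp_pos _).le)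
    hK0, hμ0, fun t ht => ?_⟩
  have ht' := h t ht
  simp only [mul_zero, Real.exp_zero, mul_one] at ht'
  rw [neg_mul, Real.exp_neg, ← div_eq_mul_inv, le_div_iff₀ (Real.exp_pos _)]
  have h4 : Real.exp (μ * t) ≤ Real.exp (φ t) := Real.exp_le_exp.mpr <|
    le_add_of_nonneg_right (by positivity)
  have h5 : 0 ≤ K * Real.exp (-(α / 2) * t) := by positivity
  nlinarith [mul_le_mul_of_nonneg_left h4 (hV0 t ht)]

lemma hasDerivAt_min_zero_sq (u : ℝ) :
    HasDerivAt (fun v : ℝ => min v 0 ^ 2) (2 * min u 0) u := by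
  have hb : ∀ v : ℝ, |min v 0 ^ 2 - min u 0 ^ 2 - (v - u) * (2 * min u 0)| ≤ |v - u| ^ 2 := by
    intro v
    rw [sq_abs, abs_le]
    rcases le_total v 0 with hv | hv <;> rcases le_total u 0 with hu | hu <;>
      simp only [min_eq_left, min_eq_right, hv, hu] <;> constructor <;> nlinarith
  rw [hasDerivAt_iff_isLittleO]
  refine Asymptotics.IsBigO.trans_isLittleO (g := fun v => |v - u| ^ 2) ?_ ?_
  · exact Asymptotics.IsBigO.of_bound 1 (Filter.Eventually.of_forall fun v => by
      simpa using hb v)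
  · have := Asymptotics.isLittleO_pow_sub_sub u (m := 2) (by norm_num)
    simpa using this

lemma laplacian_flow_nonneg {n : Type*} [Fintype n] {a : n → n → ℝ} {ξ : n → ℝ}
    (ha : ∀ i j, 0 ≤ a i j) (hξ : ∀ i, 0 < ξ i)
    (hbal : ∀ j, ∑ i, ξ i * a i j = ξ j * ∑ k, a j k) {x : ℝ → n → ℝ}
    (hx : ∀ t, 0 ≤ t → ∀ i, HasDerivAt (fun τ => x τ i) (-∑ j, a i j * (x t i - x t j)) t)
    (hx0 : ∀ i, 0 ≤ x 0 i) {t : ℝ} (ht : 0 ≤ t) (i : n) : 0 ≤ x t i := by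
  have h := le_initial_of_hasDerivAt_nonpos (f := fun s => ∑ i, ξ i * min (x s i) 0 ^ 2)
    (fun s hs => HasDerivAt.fun_sum fun i _ =>
      (((hasDerivAt_min_zero_sq (x s i)).comp s (hx s hs i)).const_mul (ξ i)))
    (fun s _ => by
      rw [← neg_nonneg, ← Finset.sum_neg_distrib]
      refine (sum_balanced_sub_eq_zero hbal fun i => min (x s i) 0 ^ 2).ge.trans
        (Finset.sum_le_sum fun i _ => ?_)
      rw [mul_neg, mul_neg, neg_neg, Finset.mul_sum, Finset.mul_sum]
      refine Finset.sum_le_sum fun j _ => ?_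
      have key : min (x s i) 0 ^ 2 - min (x s j) 0 ^ 2 ≤ 2 * min (x s i) 0 * (x s i - x s j) := by
        rcases le_total (x s i) 0 with hi | hi <;> rcases le_total (x s j) 0 with hj | hj <;>
          simp only [min_eq_left, min_eq_right, hi, hj] <;> nlinarith [sq_nonneg (x s i - x s j)]
      nlinarith [mul_le_mul_of_nonneg_left key (mul_nonneg (hξ i).le (ha i j))]) ht
  have h0 : ∑ i, ξ i * min (x 0 i) 0 ^ 2 = 0 := by simp [hx0]
  rw [h0] at h
  have hi : ξ i * min (x t i) 0 ^ 2 ≤ 0 :=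
    (Finset.single_le_sum (f := fun i => ξ i * min (x t i) 0 ^ 2)
      (fun i _ => mul_nonneg (hξ i).le (sq_nonneg _)) (Finset.mem_univ i)).trans h
  have hm : min (x t i) 0 ^ 2 = 0 :=
    le_antisymm (nonpos_of_mul_nonpos_right hi (hξ i)) (sq_nonneg _)
  exact min_eq_right_iff.mp (pow_eq_zero_iff two_ne_zero |>.mp hm)

lemma laplacian_flow_lower_bound {n : Type*} [Fintype n] {a : n → n → ℝ} {ξ : n → ℝ}
    (ha : ∀ i j, 0 ≤ a i j) (hξ : ∀ i, 0 < ξ i)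
    (hbal : ∀ j, ∑ i, ξ i * a i j = ξ j * ∑ k, a j k) {x : ℝ → n → ℝ}
    (hx : ∀ t, 0 ≤ t → ∀ i, HasDerivAt (fun τ => x τ i) (-∑ j, a i j * (x t i - x t j)) t)
    (hx0 : ∀ i, 0 ≤ x 0 i) {t : ℝ} (ht : 0 ≤ t) (i : n) :
    x 0 i * Real.exp (-(∑ j, a i j) * t) ≤ x t i := by
  have h := le_mul_exp_of_hasDerivAt_le (r := ∑ j, a i j) (fun s hs => (hx s hs i).neg)
    (fun s hs => by
      have hnn : 0 ≤ ∑ j, a i j * x s j := Finset.sum_nonneg fun j _ =>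
        mul_nonneg (ha i j) (laplacian_flow_nonneg ha hξ hbal hx hx0 hs j)
      simp only [mul_sub, Finset.sum_sub_distrib, ← Finset.sum_mul, Pi.neg_apply]
      linarith) ht
  simp only [Pi.neg_apply] at h
  linarith

lemma laplacian_flow_sum_conserved {n : Type*} [Fintype n] {a : n → n → ℝ} {ξ : n → ℝ}
    (hbal : ∀ j, ∑ i, ξ i * a i j = ξ j * ∑ k, a j k) {x : ℝ → n → ℝ} {β : ℝ}
    {u : ℝ → n → ℝ}
    (hx : ∀ t, 0 ≤ t → ∀ i, HasDerivAt (fun τ => x τ i) (β * ∑ j, a i j * (u t i - u t j)) t)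
    {t : ℝ} (ht : 0 ≤ t) : ∑ i, ξ i * x t i = ∑ i, ξ i * x 0 i := by
  have hd : ∀ s, 0 ≤ s → HasDerivAt (fun s => ∑ i, ξ i * x s i) 0 s := fun s hs => by
    refine (HasDerivAt.fun_sum fun i _ => (hx s hs i).const_mul (ξ i)).congr_deriv ?_
    have := sum_mul_laplacian_eq_zero hbal (u s)
    simp only [mul_left_comm _ β, ← Finset.mul_sum, this, mul_zero]
  refine le_antisymm (le_initial_of_hasDerivAt_nonpos hd (fun _ _ => le_rfl) ht) ?_
  have := le_initial_of_hasDerivAt_nonpos (fun s hs => (hd s hs).neg)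
    (fun _ _ => neg_zero.le) ht
  exact neg_le_neg_iff.mp this

lemma laplacian_flow_consensus {n : Type*} [Fintype n] {a : n → n → ℝ} {ξ : n → ℝ} {lam : ℝ}
    (hξ : ∀ i, 0 < ξ i) (hξ1 : ∑ i, ξ i = 1)
    (hbal : ∀ j, ∑ i, ξ i * a i j = ξ j * ∑ k, a j k)
    (hlam : ∀ (x : n → ℝ) (i j : n),
      lam * (x i - x j) ^ 2 ≤ ∑ i, ∑ j, ξ i * a i j * (x i - x j) ^ 2) (hlam0 : 0 < lam)
    {x : ℝ → n → ℝ}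
    (hx : ∀ t, 0 ≤ t → ∀ i, HasDerivAt (fun τ => x τ i) (-∑ j, a i j * (x t i - x t j)) t)
    (i : n) : ∃ K : ℝ, 0 ≤ K ∧ ∀ t, 0 ≤ t →
      |x t i - ∑ j, ξ j * x 0 j| ≤ K * Real.exp (-(lam / 2) * t) := by
  set m := ∑ j, ξ j * x 0 j with hm
  have hcons : ∀ t, 0 ≤ t → ∑ j, ξ j * x t j = m := fun t ht =>
    laplacian_flow_sum_conserved (β := -1) hbal
      (fun s hs i => (hx s hs i).congr_deriv (neg_one_mul _).symm) ht
  set V : ℝ → ℝ := fun t => ∑ i, ξ i * (x t i - m) ^ 2 with hV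
  have hVd : ∀ t, 0 ≤ t →
      HasDerivAt V (-∑ i, ∑ j, ξ i * a i j * (x t i - x t j) ^ 2) t := fun t ht => by
    refine (HasDerivAt.fun_sum fun i _ =>
      (((hx t ht i).sub_const m).pow 2).const_mul (ξ i)).congr_deriv ?_
    rw [← two_mul_sum_mul_laplacian hbal, ← sub_eq_zero, sub_neg_eq_add, Finset.mul_sum,
      ← Finset.sum_add_distrib]
    have h0 := sum_mul_laplacian_eq_zero hbal (x t)
    calc _ = ∑ i, 2 * m * (ξ i * ∑ j, a i j * (x t i - x t j)) :=
          Finset.sum_congr rfl fun i _ => by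
            push_cast
            ring
      _ = 0 := by rw [← Finset.mul_sum, h0, mul_zero]
  have hdev : ∀ t, 0 ≤ t → ∀ i,
      lam * (x t i - m) ^ 2 ≤ ∑ i, ∑ j, ξ i * a i j * (x t i - x t j) ^ 2 := fun t ht i => by
    have hrep : x t i - m = ∑ j, ξ j * (x t i - x t j) := by
      simp only [mul_sub, Finset.sum_sub_distrib, ← Finset.sum_mul, hξ1, hcons t ht, one_mul]
    have hj : (∑ j, ξ j * (x t i - x t j)) ^ 2 ≤ ∑ j, ξ j * (x t i - x t j) ^ 2 :=
      Real.pow_arith_mean_le_arith_mean_pow_of_even _ _ _ (fun j _ => (hξ j).le) hξ1 even_two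
    rw [hrep]
    calc _ ≤ lam * ∑ j, ξ j * (x t i - x t j) ^ 2 := mul_le_mul_of_nonneg_left hj hlam0.le
      _ = ∑ j, ξ j * (lam * (x t i - x t j) ^ 2) := by
        rw [Finset.mul_sum]
        exact Finset.sum_congr rfl fun _ _ => by ring
      _ ≤ ∑ j, ξ j * ∑ i, ∑ j, ξ i * a i j * (x t i - x t j) ^ 2 :=
        Finset.sum_le_sum fun j _ => mul_le_mul_of_nonneg_left (hlam _ i j) (hξ j).le
      _ = _ := by rw [← Finset.sum_mul, hξ1, one_mul]
  have hdecay := fun t (ht : 0 ≤ t) => le_mul_exp_of_hasDerivAt_le (r := lam) hVd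
    (fun s hs => by
      rw [neg_mul, neg_le_neg_iff, Finset.mul_sum]
      calc _ = ∑ i, ξ i * (lam * (x s i - m) ^ 2) :=
            Finset.sum_congr rfl fun _ _ => by ring
        _ ≤ ∑ i, ξ i * ∑ i, ∑ j, ξ i * a i j * (x s i - x s j) ^ 2 :=
          Finset.sum_le_sum fun j _ => mul_le_mul_of_nonneg_left (hdev s hs j) (hξ j).le
        _ = _ := by rw [← Finset.sum_mul, hξ1, one_mul]) ht
  have hV0 : 0 ≤ V 0 := Finset.sum_nonneg fun i _ => mul_nonneg (hξ i).le (sq_nonneg _)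
  refine ⟨√(V 0 / ξ i), Real.sqrt_nonneg _, fun t ht => ?_⟩
  refine abs_le_of_sq_le_sq ?_ (by positivity)
  rw [mul_pow, Real.sq_sqrt (div_nonneg hV0 (hξ i).le), ← Real.exp_nat_mul, div_mul_eq_mul_div,
    le_div_iff₀ (hξ i)]
  calc (x t i - m) ^ 2 * ξ i = ξ i * (x t i - m) ^ 2 := mul_comm _ _
    _ ≤ V t := Finset.single_le_sum (f := fun i => ξ i * (x t i - m) ^ 2)
        (fun i _ => mul_nonneg (hξ i).le (sq_nonneg _)) (Finset.mem_univ i)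
    _ ≤ V 0 * Real.exp (-lam * t) := hdecay t ht
    _ = _ := by
      congr 2
      push_cast
      ring

/-- Exponential convergence of a function with an exponential lower bound is inherited by its
reciprocal. -/
lemma exists_inv_sub_inv_le_exp {g : ℝ → ℝ} {ξ d α K : ℝ} (hξ : 0 < ξ) (hd : 0 ≤ d) (hα : 0 < α)
    (hK : 0 ≤ K) (hlow : ∀ t, 0 ≤ t → Real.exp (-d * t) ≤ g t)
    (hg : ∀ t, 0 ≤ t → |g t - ξ| ≤ K * Real.exp (-α * t)) :
    ∃ K' : ℝ, 0 ≤ K' ∧ ∀ t, 0 ≤ t → |1 / g t - 1 / ξ| ≤ K' * Real.exp (-α * t) := by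
  obtain ⟨T, hT⟩ : ∃ T, ∀ t, T ≤ t → K * Real.exp (-α * t) ≤ ξ / 2 := by
    have h : Filter.Tendsto (fun t => K * Real.exp (-α * t)) Filter.atTop (nhds 0) := by
      have := (Real.tendsto_exp_atBot.comp
        (Filter.tendsto_id.const_mul_atTop_of_neg (neg_neg_of_pos hα))).const_mul K
      simpa using this
    exact Filter.eventually_atTop.mp (h.eventually (ge_mem_nhds (half_pos hξ)))
  set b := min (Real.exp (-d * T)) (ξ / 2) with hb
  have hb0 : 0 < b := lt_min (Real.exp_pos _) (half_pos hξ)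
  have hbg : ∀ t, 0 ≤ t → b ≤ g t := fun t ht => by
    rcases le_total t T with h | h
    · exact (min_le_left _ _).trans ((Real.exp_le_exp.mpr (by nlinarith)).trans (hlow t ht))
    · have := (abs_le.mp ((hg t ht).trans (hT t h))).1
      exact (min_le_right _ _).trans (by linarith)
  refine ⟨K / (b * ξ), by positivity, fun t ht => ?_⟩
  have hgt : 0 < g t := hb0.trans_le (hbg t ht)
  rw [div_sub_div _ _ hgt.ne' hξ.ne', abs_div, abs_of_pos (mul_pos hgt hξ), one_mul, mul_one,
    abs_sub_comm, div_mul_eq_mul_div]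
  exact div_le_div₀ (by positivity) (hg t ht) (by positivity)
    (mul_le_mul_of_nonneg_right (hbg t ht) hξ.le)

lemma exists_one_le_forall_le {n : Type*} [Fintype n] (x : n → ℝ) :
    ∃ k : ℝ, 1 ≤ k ∧ ∀ i, x i ≤ k := by
  have h : ∀ i, |x i| ≤ ∑ j, |x j| := fun i =>
    Finset.single_le_sum (fun j _ => abs_nonneg (x j)) (Finset.mem_univ i)
  exact ⟨1 + ∑ j, |x j|, le_add_of_nonneg_right (Finset.sum_nonneg fun _ _ => abs_nonneg _),
    fun i => by linarith [h i, le_abs_self (x i)]⟩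

/-- Dissipation inequality for the Lyapunov function `∑ ξ (k e² + (e + w)²) / 2` of the
coordinator, with `g` the gradient increments and `r` the perturbation caused by estimating the
weights `ξ`. -/
lemma coordinator_dissipation {n : Type*} [Fintype n] [Nonempty n] {a : n → n → ℝ}
    {ξ ϖ ι : n → ℝ} {lam k β : ℝ} (hξ : ∀ i, 0 < ξ i) (hξ1 : ∑ i, ξ i = 1)
    (hbal : ∀ j, ∑ i, ξ i * a i j = ξ j * ∑ k, a j k)
    (hlam : ∀ (x : n → ℝ) (i j : n),
      lam * (x i - x j) ^ 2 ≤ ∑ i, ∑ j, ξ i * a i j * (x i - x j) ^ 2) (hlam0 : 0 < lam)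
    (hk1 : 1 ≤ k) (hk : ∀ i, ι i ^ 2 ≤ k * (ϖ i * ξ i)) (hβ : k * β * lam = 2 * (k + 1) ^ 2)
    {e w g r : n → ℝ} (hw : ∑ i, ξ i * w i = 0) (hg : ∀ i, ϖ i * e i ^ 2 ≤ e i * g i)
    (hgl : ∀ i, |g i| ≤ ι i * |e i|) :
    ∑ i, ξ i * (k * (e i * (-(g i / ξ i) - r i - β * ∑ j, a i j * (e i - e j) - w i)) +
        (e i + w i) * (-(g i / ξ i) - r i - w i)) ≤
      -∑ i, (ϖ i * e i ^ 2 + ξ i * w i ^ 2 / 2) +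
        ∑ i, ξ i * (|r i| * ((k + 1) * |e i| + |w i|)) := by
  obtain ⟨o⟩ := ‹Nonempty n›
  have hterm : ∀ i ∈ Finset.univ,
      ξ i * (k * (e i * (-(g i / ξ i) - r i - β * ∑ j, a i j * (e i - e j) - w i)) +
        (e i + w i) * (-(g i / ξ i) - r i - w i)) ≤
      -(ϖ i * e i ^ 2 + ξ i * w i ^ 2 / 2) + ξ i * (|r i| * ((k + 1) * |e i| + |w i|)) +
        (-(k * β) * (ξ i * (e i * ∑ j, a i j * (e i - e j))) +
          (k + 1) ^ 2 * (ξ i * (e i - e o) ^ 2) - (k + 1) * e o * (ξ i * w i)) := by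
    intro i _
    set ℓ := ∑ j, a i j * (e i - e j)
    have hx := hξ i
    have hexpand : ξ i * (k * (e i * (-(g i / ξ i) - r i - β * ℓ - w i)) +
        (e i + w i) * (-(g i / ξ i) - r i - w i)) =
        -(k + 1) * (e i * g i) - w i * g i - ξ i * w i ^ 2 - (k + 1) * ξ i * (e i * w i)
          - k * β * (ξ i * (e i * ℓ)) - ξ i * (r i * ((k + 1) * e i + w i)) := by
      field_simp
      ring
    have hr : -(r i * ((k + 1) * e i + w i)) ≤ |r i| * ((k + 1) * |e i| + |w i|) := by
      have h1 : |(k + 1) * e i + w i| ≤ (k + 1) * |e i| + |w i| := by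
        refine (abs_add_le _ _).trans_eq ?_
        rw [abs_mul, abs_of_pos (by linarith : 0 < k + 1)]
      exact (neg_le_abs _).trans ((abs_mul _ _).trans_le
        (mul_le_mul_of_nonneg_left h1 (abs_nonneg _)))
    have hwg : -(w i * g i) ≤ ξ i * w i ^ 2 / 4 + k * (ϖ i * e i ^ 2) := by
      have hg2 : g i ^ 2 ≤ ι i ^ 2 * e i ^ 2 := by
        rw [← sq_abs (g i), ← sq_abs (e i), ← mul_pow]
        exact pow_le_pow_left₀ (abs_nonneg _) (hgl i) 2
      have hg3 : g i ^ 2 ≤ ξ i * (k * (ϖ i * e i ^ 2)) :=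
        hg2.trans ((mul_le_mul_of_nonneg_right (hk i) (sq_nonneg _)).trans_eq (by ring))
      refine le_of_mul_le_mul_left ?_ hx
      nlinarith [sq_nonneg (ξ i * w i / 2 + g i)]
    have hcross : -((k + 1) * ξ i * (e i * w i)) ≤
        (k + 1) ^ 2 * (ξ i * (e i - e o) ^ 2) + ξ i * w i ^ 2 / 4
          - (k + 1) * e o * (ξ i * w i) := by
      nlinarith [mul_nonneg hx.le (sq_nonneg ((k + 1) * (e i - e o) + w i / 2))]
    rw [hexpand]
    nlinarith [mul_le_mul_of_nonneg_left hr hx.le,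
      mul_le_mul_of_nonneg_left (hg i) (by linarith : 0 ≤ k + 1)]
  refine (Finset.sum_le_sum hterm).trans ?_
  simp only [Finset.sum_add_distrib, Finset.sum_sub_distrib, Finset.sum_neg_distrib,
    ← Finset.mul_sum, hw, mul_zero, sub_zero]
  have hE := two_mul_sum_mul_laplacian hbal e
  set E := ∑ i, ∑ j, ξ i * a i j * (e i - e j) ^ 2
  have hsq : lam * ∑ i, ξ i * (e i - e o) ^ 2 ≤ E := by
    calc _ = ∑ i, ξ i * (lam * (e i - e o) ^ 2) := by
          rw [Finset.mul_sum]
          exact Finset.sum_congr rfl fun _ _ => by ring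
      _ ≤ ∑ i, ξ i * E := Finset.sum_le_sum fun i _ =>
          mul_le_mul_of_nonneg_left (hlam e i o) (hξ i).le
      _ = E := by rw [← Finset.sum_mul, hξ1, one_mul]
  have hfin : -(k * β) * ∑ i, ξ i * (e i * ∑ j, a i j * (e i - e j)) +
      (k + 1) ^ 2 * ∑ i, ξ i * (e i - e o) ^ 2 ≤ 0 := by
    refine nonpos_of_mul_nonpos_right (a := lam) ?_ hlam0
    have heq : lam * (-(k * β) * ∑ i, ξ i * (e i * ∑ j, a i j * (e i - e j)) +
        (k + 1) ^ 2 * ∑ i, ξ i * (e i - e o) ^ 2) =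
        (k + 1) ^ 2 * (lam * ∑ i, ξ i * (e i - e o) ^ 2 - E) := by
      rw [← hE]
      linear_combination -(∑ i, ξ i * (e i * ∑ j, a i j * (e i - e j))) * hβ
    rw [heq]
    exact mul_nonpos_of_nonneg_of_nonpos (sq_nonneg _) (sub_nonpos.mpr hsq)
  linarith

/-- Exponential decay of the Lyapunov function of the coordinator in error coordinates. -/
lemma coordinator_error_decay {n : Type*} [Fintype n] [Nonempty n] {a : n → n → ℝ}
    {ξ ϖ ι b : n → ℝ} {lam k β K α : ℝ} (hξ : ∀ i, 0 < ξ i) (hξ1 : ∑ i, ξ i = 1)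
    (hbal : ∀ j, ∑ i, ξ i * a i j = ξ j * ∑ k, a j k)
    (hlam : ∀ (x : n → ℝ) (i j : n),
      lam * (x i - x j) ^ 2 ≤ ∑ i, ∑ j, ξ i * a i j * (x i - x j) ^ 2) (hlam0 : 0 < lam)
    (hϖ : ∀ i, 0 < ϖ i)
    (hk1 : 1 ≤ k) (hk : ∀ i, ι i ^ 2 ≤ k * (ϖ i * ξ i)) (hβ : k * β * lam = 2 * (k + 1) ^ 2)
    (hK : 0 ≤ K) (hα : 0 < α) {e w g δ : ℝ → n → ℝ}
    (hw : ∀ t, 0 ≤ t → ∑ i, ξ i * w t i = 0)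
    (hg : ∀ t, 0 ≤ t → ∀ i, ϖ i * e t i ^ 2 ≤ e t i * g t i)
    (hgl : ∀ t, 0 ≤ t → ∀ i, |g t i| ≤ ι i * |e t i|)
    (hδ : ∀ t, 0 ≤ t → ∀ i, |δ t i| ≤ K * Real.exp (-α * t))
    (hed : ∀ t, 0 ≤ t → ∀ i, HasDerivAt (fun τ => e τ i)
      (-(g t i / ξ i) - δ t i * (g t i + b i) - β * ∑ j, a i j * (e t i - e t j) - w t i) t)
    (hwd : ∀ t, 0 ≤ t → ∀ i, HasDerivAt (fun τ => w τ i)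
      (β * ∑ j, a i j * (e t i - e t j)) t) :
    ∃ C μ : ℝ, 0 ≤ C ∧ 0 < μ ∧
      ∀ t, 0 ≤ t → ∑ i, ξ i * e t i ^ 2 ≤ C * Real.exp (-μ * t) := by
  set V : ℝ → ℝ := fun t => ∑ i, ξ i * (k / 2 * e t i ^ 2 + 1 / 2 * (e t i + w t i) ^ 2) with hV
  have hVd : ∀ t, 0 ≤ t → HasDerivAt V (∑ i, ξ i *
      (k * (e t i * (-(g t i / ξ i) - δ t i * (g t i + b i) -
        β * ∑ j, a i j * (e t i - e t j) - w t i)) +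
        (e t i + w t i) * (-(g t i / ξ i) - δ t i * (g t i + b i) - w t i))) t := fun t ht => by
    refine (HasDerivAt.fun_sum fun i _ =>
      ((((hed t ht i).pow 2).const_mul (k / 2)).add
        ((((hed t ht i).add (hwd t ht i)).pow 2).const_mul (1 / 2))).const_mul (ξ i)).congr_deriv
      (Finset.sum_congr rfl fun i _ => ?_)
    simp only [Pi.add_apply]
    push_cast
    ring
  have hVterm : ∀ t i, 0 ≤ ξ i * (k / 2 * e t i ^ 2 + 1 / 2 * (e t i + w t i) ^ 2) := fun t i =>
    mul_nonneg (hξ i).le (by positivity)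
  have hV0 : ∀ t, 0 ≤ t → 0 ≤ V t := fun t _ => Finset.sum_nonneg fun i _ => hVterm t i
  have hVlow : ∀ t, ∑ i, ξ i * (e t i ^ 2 + w t i ^ 2) ≤ 10 * V t := fun t => by
    rw [hV, Finset.mul_sum]
    refine Finset.sum_le_sum fun i _ => ?_
    have : e t i ^ 2 + w t i ^ 2 ≤
        10 * (k / 2 * e t i ^ 2 + 1 / 2 * (e t i + w t i) ^ 2) := by
      nlinarith [sq_nonneg (2 * e t i + w t i), sq_nonneg (e t i + w t i), sq_nonneg (w t i),
        mul_le_mul_of_nonneg_right hk1 (sq_nonneg (e t i)), sq_nonneg (e t i)]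
    nlinarith [mul_le_mul_of_nonneg_left this (hξ i).le]
  obtain ⟨κ, hκ1, hκ⟩ := exists_one_le_forall_le fun i => (k + 2) * ξ i / ϖ i
  obtain ⟨M, hM1, hM⟩ := exists_one_le_forall_le fun i => ι i ^ 2 + b i ^ 2 + (k + 1) ^ 2 + 1
  have hVup : ∀ t, 1 / (2 * κ) * V t ≤ ∑ i, (ϖ i * e t i ^ 2 + ξ i * w t i ^ 2 / 2) :=
    fun t => by
    rw [one_div_mul_eq_div, div_le_iff₀ (by linarith), hV, Finset.sum_mul]
    refine Finset.sum_le_sum fun i _ => ?_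
    have h1 : (k + 2) * ξ i ≤ κ * ϖ i := (div_le_iff₀ (hϖ i)).mp (hκ i)
    have h2 := mul_le_mul_of_nonneg_right h1 (sq_nonneg (e t i))
    have h3 : 0 ≤ κ * (ϖ i * e t i ^ 2) :=
      mul_nonneg (by linarith) (mul_nonneg (hϖ i).le (sq_nonneg _))
    have h4 := mul_le_mul_of_nonneg_right hκ1 (mul_nonneg (hξ i).le (sq_nonneg (w t i)))
    nlinarith [mul_nonneg (hξ i).le (sq_nonneg (e t i - w t i))]
  have hpert : ∀ t, 0 ≤ t →
      ∑ i, ξ i * (|δ t i * (g t i + b i)| * ((k + 1) * |e t i| + |w t i|)) ≤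
        10 * K * M * Real.exp (-α * t) * (V t + 1) := fun t ht => by
    have hi : ∀ i ∈ Finset.univ,
        ξ i * (|δ t i * (g t i + b i)| * ((k + 1) * |e t i| + |w t i|)) ≤
          K * Real.exp (-α * t) * M * (ξ i + ξ i * (e t i ^ 2 + w t i ^ 2)) := fun i _ => by
      have hgb : |g t i + b i| ≤ ι i * |e t i| + |b i| :=
        (abs_add_le _ _).trans (add_le_add_left (hgl t ht i) _)
      have hk0 : 0 ≤ (k + 1) * |e t i| + |w t i| := by positivity
      have hprod : |g t i + b i| * ((k + 1) * |e t i| + |w t i|) ≤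
          M * (1 + (e t i ^ 2 + w t i ^ 2)) := by
        have h1 : |g t i + b i| * ((k + 1) * |e t i| + |w t i|) ≤
            ι i ^ 2 * e t i ^ 2 + b i ^ 2 + ((k + 1) ^ 2 * e t i ^ 2 + w t i ^ 2) := by
          refine (mul_le_mul_of_nonneg_right hgb hk0).trans ?_
          rw [← sq_abs (e t i), ← sq_abs (w t i), ← sq_abs (b i)]
          nlinarith [sq_nonneg (ι i * |e t i| + |b i| - ((k + 1) * |e t i| + |w t i|)),
            sq_nonneg (ι i * |e t i| - |b i|), sq_nonneg ((k + 1) * |e t i| - |w t i|)]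
        nlinarith [mul_le_mul_of_nonneg_right (hM i)
            (by positivity : 0 ≤ 1 + (e t i ^ 2 + w t i ^ 2)),
          mul_nonneg (sq_nonneg (ι i)) (sq_nonneg (w t i)), sq_nonneg (ι i), sq_nonneg (k + 1),
          mul_nonneg (sq_nonneg (b i)) (sq_nonneg (w t i)), sq_nonneg (e t i),
          mul_nonneg (sq_nonneg (b i)) (sq_nonneg (e t i)), sq_nonneg (w t i),
          mul_nonneg (sq_nonneg (k + 1)) (sq_nonneg (w t i))]
      calc _ = ξ i * (|δ t i| * (|g t i + b i| * ((k + 1) * |e t i| + |w t i|))) := by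
            rw [abs_mul, mul_assoc]
        _ ≤ ξ i * (K * Real.exp (-α * t) * (M * (1 + (e t i ^ 2 + w t i ^ 2)))) :=
            mul_le_mul_of_nonneg_left (mul_le_mul (hδ t ht i) hprod
              (mul_nonneg (abs_nonneg _) hk0) (by positivity)) (hξ i).le
        _ = _ := by ring
    refine (Finset.sum_le_sum hi).trans ?_
    rw [← Finset.mul_sum, Finset.sum_add_distrib, hξ1]
    have h0 : 0 ≤ K * Real.exp (-α * t) * M := by positivity
    nlinarith [mul_le_mul_of_nonneg_left (hVlow t) h0]
  obtain ⟨C, μ, hC, hμ, hdecay⟩ := exists_exp_bound_of_perturbed_decay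
    (ρ := 1 / (2 * κ)) (α := α) (M := 10 * K * M) (by positivity) hα (by positivity) hVd hV0
    fun t ht => by
      have := coordinator_dissipation hξ hξ1 hbal hlam hlam0 hk1 hk hβ
        (r := fun i => δ t i * (g t i + b i)) (hw t ht) (hg t ht) (hgl t ht)
      linarith [hVup t, hpert t ht]
  refine ⟨10 * C, μ, by positivity, hμ, fun t ht => ?_⟩
  have hle : ∑ i, ξ i * e t i ^ 2 ≤ ∑ i, ξ i * (e t i ^ 2 + w t i ^ 2) :=
    Finset.sum_le_sum fun i _ => mul_le_mul_of_nonneg_left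
      (le_add_of_nonneg_right (sq_nonneg _)) (hξ i).le
  linarith [hVlow t, hdecay t ht]

lemma sum_deriv_eq_zero_of_minimizer {n : Type*} [Fintype n] {c c' : n → ℝ → ℝ} {s : ℝ}
    (hderiv : ∀ i x, HasDerivAt (c i) (c' i x) x) (hs : ∀ x, ∑ i, c i s ≤ ∑ i, c i x) :
    ∑ i, c' i s = 0 :=
  IsLocalMin.hasDerivAt_eq_zero (f := fun x => ∑ i, c i x) (Filter.Eventually.of_forall hs)
    (HasDerivAt.fun_sum fun i _ => hderiv i s)

lemma laplacian_mul_apply {n : Type*} [Fintype n] [DecidableEq n] {a : n → n → ℝ}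
    {L : Matrix n n ℝ} (hdiag : ∀ i, a i i = 0)
    (hL : ∀ i j, L i j = if i = j then ∑ k, a i k else -(a i j)) (X : Matrix n n ℝ) (i j : n) :
    (L * X) i j = ∑ k, a i k * (X i j - X k j) := by
  have hL' : ∀ k, L i k = (if i = k then ∑ k, a i k else 0) - a i k := fun k => by
    rw [hL]
    split_ifs with h
    · rw [← h, hdiag, sub_zero]
    · rw [zero_sub]
  simp [Matrix.mul_apply, hL', sub_mul, mul_sub, Finset.sum_mul]

/-- Theorem 1 of the paper. For a strongly connected weighted
digraph with Laplacian `L` and strongly convex local costs with Lipschitz gradients,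
there exist gains `β₁, β₂ > 0` such that for any solution of the distributed optimal
coordinator
`(y_i^r)' = -(1/Ξ_{ii}) c_i'(y_i^r) - β₁ ∑_j a_{ij}(y_i^r - y_j^r) - β₂ z_i`,
`z_i' = β₁ ∑_j a_{ij}(y_i^r - y_j^r)`, `Ξ' = -L Ξ`, `Ξ(0) = I`, `z(0) = 0`:
(a) `Ξ(t)_{ii} > 0` for all `t ≥ 0` (so the equations are well defined);
(b) `y^r` is bounded on `[0,∞)`;
(c) `y^r(t)` converges exponentially to `s* 𝟏_N`, where `s*` is the unique minimizer
of the global cost. -/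
theorem optimal_coordinator_exponential_convergence
    (N : ℕ) (hN : 2 ≤ N) (a : Fin N → Fin N → ℝ)
    (ha_nonneg : ∀ i j, 0 ≤ a i j) (ha_diag : ∀ i, a i i = 0)
    (hconn : ∀ i j : Fin N, i ≠ j →
      Relation.TransGen (fun p q : Fin N => 0 < a q p) i j)
    (L : Matrix (Fin N) (Fin N) ℝ)
    (hL : ∀ i j, L i j = if i = j then ∑ k, a i k else -(a i j))
    (c c' : Fin N → ℝ → ℝ)
    (hderiv : ∀ (i : Fin N) (x : ℝ), HasDerivAt (c i) (c' i x) x)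
    (ϖ ι : Fin N → ℝ) (hϖ : ∀ i, 0 < ϖ i) (hι : ∀ i, 0 < ι i)
    (hconv : ∀ (i : Fin N) (x y : ℝ),
      ϖ i * (x - y) ^ 2 ≤ (x - y) * (c' i x - c' i y))
    (hlip : ∀ (i : Fin N) (x y : ℝ), |c' i x - c' i y| ≤ ι i * |x - y|)
    (sstar : ℝ) (hstar : ∀ s : ℝ, ∑ i, c i sstar ≤ ∑ i, c i s) :
    ∃ β₁ β₂ : ℝ, 0 < β₁ ∧ 0 < β₂ ∧
      ∀ (Ξ : ℝ → Matrix (Fin N) (Fin N) ℝ) (yr z : ℝ → Fin N → ℝ),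
        (∀ t : ℝ, 0 ≤ t → ∀ i j : Fin N,
          HasDerivAt (fun τ => Ξ τ i j) ((-(L * Ξ t)) i j) t) →
        Ξ 0 = 1 →
        z 0 = 0 →
        (∀ t : ℝ, 0 ≤ t → ∀ i : Fin N,
          HasDerivAt (fun τ => yr τ i)
            (-(1 / Ξ t i i) * c' i (yr t i)
              - β₁ * ∑ j, a i j * (yr t i - yr t j) - β₂ * z t i) t) →
        (∀ t : ℝ, 0 ≤ t → ∀ i : Fin N,
          HasDerivAt (fun τ => z τ i)
            (β₁ * ∑ j, a i j * (yr t i - yr t j)) t) →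
        (∀ t : ℝ, 0 ≤ t → ∀ i : Fin N, 0 < Ξ t i i) ∧
        (∃ B : ℝ, ∀ t : ℝ, 0 ≤ t → ∀ i : Fin N, |yr t i| ≤ B) ∧
        (∃ C : ℝ, 0 ≤ C ∧ ∃ μ : ℝ, 0 < μ ∧ ∀ t : ℝ, 0 ≤ t →
          Real.sqrt (∑ i, (yr t i - sstar) ^ 2) ≤ C * Real.exp (-μ * t)) := by
  have : Nonempty (Fin N) := ⟨⟨0, by omega⟩⟩
  obtain ⟨ξ, hξ, hξ1, hbal⟩ := exists_pos_balancing_weights ha_nonneg hconn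
  obtain ⟨lam, hlam0, hlam⟩ := exists_dirichlet_gap ha_nonneg hconn hξ
  obtain ⟨k, hk1, hk⟩ := exists_one_le_forall_le fun i => ι i ^ 2 / (ϖ i * ξ i)
  have hk' : ∀ i, ι i ^ 2 ≤ k * (ϖ i * ξ i) := fun i =>
    (div_le_iff₀ (mul_pos (hϖ i) (hξ i))).mp (hk i)
  have hcrit := sum_deriv_eq_zero_of_minimizer hderiv hstar
  set β := 2 * (k + 1) ^ 2 / (k * lam) with hβ
  have hkβ : k * β * lam = 2 * (k + 1) ^ 2 := by
    rw [hβ]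
    field_simp
  refine ⟨β, 1, by positivity, one_pos, fun Ξ yr z hΞ hΞ0 hz0 hyr hz => ?_⟩
  have hcol : ∀ j t, 0 ≤ t → ∀ i, HasDerivAt (fun τ => Ξ τ i j)
      (-∑ k, a i k * (Ξ t i j - Ξ t k j)) t := fun j t ht i =>
    (hΞ t ht i j).congr_deriv <| by
      rw [Matrix.neg_apply, laplacian_mul_apply ha_diag hL]
  have hlow : ∀ i t, 0 ≤ t → Real.exp (-(∑ j, a i j) * t) ≤ Ξ t i i := fun i t ht => by
    have := laplacian_flow_lower_bound (x := fun τ l => Ξ τ l i) ha_nonneg hξ hbal (hcol i)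
      (fun l => by
        rw [hΞ0, Matrix.one_apply]
        split_ifs <;> norm_num) ht i
    simpa [hΞ0] using this
  have hconsensus : ∀ i, ∃ K' : ℝ, 0 ≤ K' ∧
      ∀ t, 0 ≤ t → |1 / Ξ t i i - 1 / ξ i| ≤ K' * Real.exp (-(lam / 2) * t) := fun i => by
    obtain ⟨K, hK, hKt⟩ := laplacian_flow_consensus (x := fun τ l => Ξ τ l i) hξ hξ1 hbal hlam
      hlam0 (hcol i) i
    refine exists_inv_sub_inv_le_exp (hξ i) (Finset.sum_nonneg fun j _ => ha_nonneg i j)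
      (half_pos hlam0) hK (hlow i) fun t ht => ?_
    simpa [hΞ0, Matrix.one_apply] using hKt t ht
  choose K' _ hKt using hconsensus
  obtain ⟨K, hK1, hK⟩ := exists_one_le_forall_le K'
  obtain ⟨C, μ, hC, hμ, hdecay⟩ := coordinator_error_decay (K := K) (α := lam / 2)
    (e := fun t i => yr t i - sstar) (w := fun t i => z t i + c' i sstar / ξ i)
    (g := fun t i => c' i (yr t i) - c' i sstar) (b := fun i => c' i sstar)
    (δ := fun t i => 1 / Ξ t i i - 1 / ξ i)
    hξ hξ1 hbal hlam hlam0 hϖ hk1 hk' hkβ (by linarith) (half_pos hlam0)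
    (fun t ht => by
      have hz' := laplacian_flow_sum_conserved hbal hz ht
      simp only [hz0, Pi.zero_apply, mul_zero, Finset.sum_const_zero] at hz'
      simp only [mul_add, Finset.sum_add_distrib, hz', zero_add]
      rw [← hcrit]
      exact Finset.sum_congr rfl fun i _ => mul_div_cancel₀ _ (hξ i).ne')
    (fun t _ i => hconv i _ _) (fun t _ i => hlip i _ _)
    (fun t ht i => (hKt i t ht).trans
      (mul_le_mul_of_nonneg_right (hK i) (Real.exp_pos _).le))
    (fun t ht i => ((hyr t ht i).sub_const sstar).congr_deriv <| by
      simp only [sub_sub_sub_cancel_right]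
      ring)
    (fun t ht i => ((hz t ht i).add_const _).congr_deriv <| by
      simp only [sub_sub_sub_cancel_right])
  obtain ⟨H, hH1, hH⟩ := exists_one_le_forall_le fun i => 1 / ξ i
  have hsq : ∀ t, 0 ≤ t → ∑ i, (yr t i - sstar) ^ 2 ≤ H * C * Real.exp (-μ * t) := fun t ht => by
    calc _ ≤ ∑ i, H * (ξ i * (yr t i - sstar) ^ 2) := Finset.sum_le_sum fun i _ => by
          have := (div_le_iff₀ (hξ i)).mp (hH i)
          nlinarith [mul_le_mul_of_nonneg_right this (sq_nonneg (yr t i - sstar))]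
      _ ≤ H * (C * Real.exp (-μ * t)) := by
          rw [← Finset.mul_sum]
          exact mul_le_mul_of_nonneg_left (hdecay t ht) (by linarith)
      _ = _ := by ring
  have hconv_exp : ∀ t, 0 ≤ t →
      √(∑ i, (yr t i - sstar) ^ 2) ≤ √(H * C) * Real.exp (-(μ / 2) * t) := fun t ht => by
    refine (Real.sqrt_le_sqrt (hsq t ht)).trans_eq ?_
    rw [Real.sqrt_mul (by positivity), ← Real.exp_half]
    congr 2
    ring
  refine ⟨fun t ht i => (Real.exp_pos _).trans_le (hlow i t ht),
    ⟨√(H * C) + |sstar|, fun t ht i => ?_⟩,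
    √(H * C), Real.sqrt_nonneg _, μ / 2, half_pos hμ, hconv_exp⟩
  have h1 : |yr t i - sstar| ≤ √(∑ i, (yr t i - sstar) ^ 2) :=
    Real.abs_le_sqrt (Finset.single_le_sum (f := fun i => (yr t i - sstar) ^ 2)
      (fun _ _ => sq_nonneg _) (Finset.mem_univ i))
  have h2 : √(H * C) * Real.exp (-(μ / 2) * t) ≤ √(H * C) :=
    mul_le_of_le_one_right (Real.sqrt_nonneg _) (Real.exp_le_one_iff.mpr (by nlinarith))
  calc |yr t i| = |(yr t i - sstar) + sstar| := by rw [sub_add_cancel]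
    _ ≤ |yr t i - sstar| + |sstar| := abs_add_le _ _
    _ ≤ _ := by linarith [hconv_exp t ht]
end

section
/- Let L be the Laplacian of a strongly connected weighted digraph on N nodes. Then there exists a vector ρ ∈ ℝ^N with all entries strictly positive such that ρᵀ L = 0 (i.e., ρ is a left eigenvector of L associated with the zero eigenvalue) and ∑_{i=1}^N ρ_i = 1. -/
open Matrix

/-- The entries of `ρᵀ L`, for `L` the Laplacian of a loopless weighted digraph. -/
lemma vecMul_laplacian_apply {ι : Type*} [Fintype ι] [DecidableEq ι] {a : ι → ι → ℝ}
    (ha_diag : ∀ i, a i i = 0) {L : Matrix ι ι ℝ}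
    (hL : ∀ i j, L i j = if i = j then ∑ k, a i k else -(a i j)) (ρ : ι → ℝ) (j : ι) :
    (ρ ᵥ* L) j = ρ j * ∑ k, a j k - ∑ i, ρ i * a i j := by
  have hterm : ∀ i, ρ i * L i j = (if i = j then ρ i * ∑ k, a i k else 0) - ρ i * a i j := by
    intro i
    rw [hL]
    split_ifs with h
    · subst h
      simp [ha_diag]
    · ring
  simp only [vecMul, dotProduct, hterm, Finset.sum_sub_distrib, Finset.sum_ite_eq',
    Finset.mem_univ, if_true]

/-- The Laplacian of a loopless weighted digraph is singular, since it annihilates constants. -/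
lemma det_laplacian_eq_zero {ι : Type*} [Fintype ι] [DecidableEq ι] [Nonempty ι]
    {a : ι → ι → ℝ} (ha_diag : ∀ i, a i i = 0) {L : Matrix ι ι ℝ}
    (hL : ∀ i j, L i j = if i = j then ∑ k, a i k else -(a i j)) : L.det = 0 := by
  refine exists_mulVec_eq_zero_iff.1 ⟨1, one_ne_zero, ?_⟩
  ext i
  have hterm : ∀ j, L i j = (if i = j then ∑ k, a i k else 0) - a i j := by
    intro j
    rw [hL]
    split_ifs with h
    · subst h
      simp [ha_diag]
    · ring
  simp [mulVec, dotProduct, hterm, Finset.sum_sub_distrib]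

/-- The entrywise absolute value of a solution of the balance equations
`v j * ∑ k, a j k = ∑ i, v i * a i j` is again a solution. -/
lemma abs_balance {ι : Type*} [Fintype ι] {a : ι → ι → ℝ} (ha : ∀ i j, 0 ≤ a i j)
    {v : ι → ℝ} (hv : ∀ j, v j * ∑ k, a j k = ∑ i, v i * a i j) (j : ι) :
    |v j| * ∑ k, a j k = ∑ i, |v i| * a i j := by
  have hle : ∀ j ∈ Finset.univ, |v j| * ∑ k, a j k ≤ ∑ i, |v i| * a i j := by
    intro j _
    calc |v j| * ∑ k, a j k = |∑ i, v i * a i j| := by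
          rw [← hv, abs_mul, abs_of_nonneg (Finset.sum_nonneg fun k _ => ha j k)]
      _ ≤ ∑ i, |v i * a i j| := Finset.abs_sum_le_sum_abs _ _
      _ = ∑ i, |v i| * a i j := by simp only [abs_mul, abs_of_nonneg (ha _ _)]
  have hsum : ∑ j, |v j| * ∑ k, a j k = ∑ j, ∑ i, |v i| * a i j := by
    rw [Finset.sum_comm]
    simp only [Finset.mul_sum]
  exact (Finset.sum_eq_sum_iff_of_le hle).1 hsum j (Finset.mem_univ j)

/-- On a strongly connected weighted digraph, a nonzero nonnegative solution of the balance
equations is strictly positive. -/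
lemma pos_of_balance {ι : Type*} [Fintype ι] {a : ι → ι → ℝ} (ha : ∀ i j, 0 ≤ a i j)
    (hconn : ∀ i j, i ≠ j → Relation.TransGen (fun p q => 0 < a q p) i j)
    {w : ι → ℝ} (hw : ∀ i, 0 ≤ w i) (hw0 : w ≠ 0)
    (hbal : ∀ j, w j * ∑ k, a j k = ∑ i, w i * a i j) (i : ι) : 0 < w i := by
  refine (hw i).lt_of_ne' fun hi => hw0 (funext fun j => ?_)
  have step : ∀ p q, 0 < a q p → w p = 0 → w q = 0 := by
    intro p q hqp hp
    have hsum : ∑ i, w i * a i p = 0 := by rw [← hbal, hp, zero_mul]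
    have hq := (Finset.sum_eq_zero_iff_of_nonneg fun i _ => mul_nonneg (hw i) (ha i p)).1
      hsum q (Finset.mem_univ q)
    exact (mul_eq_zero.1 hq).resolve_right hqp.ne'
  by_cases hij : i = j
  · exact hij ▸ hi
  · induction hconn i j hij with
    | single h => exact step _ _ h hi
    | tail _ h ih =>
      rename_i b _ _
      by_cases hb : i = b
      · exact step _ _ h (hb ▸ hi)
      · exact step _ _ h (ih hb)

/-- The Laplacian of a strongly connected weighted digraph has a
strictly positive left eigenvector `ρ` associated with the zero eigenvalue,
normalized so that `∑ i, ρ i = 1`. -/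
theorem laplacian_positive_left_eigenvector
    (N : ℕ) (hN : 2 ≤ N) (a : Fin N → Fin N → ℝ)
    (ha_nonneg : ∀ i j, 0 ≤ a i j) (ha_diag : ∀ i, a i i = 0)
    (hconn : ∀ i j : Fin N, i ≠ j →
      Relation.TransGen (fun p q : Fin N => 0 < a q p) i j)
    (L : Matrix (Fin N) (Fin N) ℝ)
    (hL : ∀ i j, L i j = if i = j then ∑ k, a i k else -(a i j)) :
    ∃ ρ : Fin N → ℝ, (∀ i, 0 < ρ i) ∧ Matrix.vecMul ρ L = 0 ∧ ∑ i, ρ i = 1 := by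
  have : Nonempty (Fin N) := ⟨⟨0, by omega⟩⟩
  obtain ⟨v, hv0, hv⟩ := exists_vecMul_eq_zero_iff.2 (det_laplacian_eq_zero ha_diag hL)
  have hbal := abs_balance ha_nonneg (v := v) fun j => sub_eq_zero.1 <| by
    rw [← vecMul_laplacian_apply ha_diag hL, hv, Pi.zero_apply]
  set w : Fin N → ℝ := fun i => |v i|
  have hw0 : w ≠ 0 := fun h => hv0 (funext fun i => abs_eq_zero.1 (congrFun h i))
  have hpos : ∀ i, 0 < w i :=
    pos_of_balance ha_nonneg hconn (fun i => abs_nonneg (v i)) hw0 hbal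
  have hS : 0 < ∑ i, w i := Finset.sum_pos (fun i _ => hpos i) Finset.univ_nonempty
  have hwL : w ᵥ* L = 0 := funext fun j => by
    rw [vecMul_laplacian_apply ha_diag hL]
    exact sub_eq_zero.2 (hbal j)
  refine ⟨(∑ i, w i)⁻¹ • w, fun i => mul_pos (inv_pos.2 hS) (hpos i), ?_, ?_⟩
  · rw [smul_vecMul, hwL, smul_zero]
  · simp only [Pi.smul_apply, smul_eq_mul, ← Finset.mul_sum]
    exact inv_mul_cancel₀ hS.ne'
end

section
/- Let L be the Laplacian of a strongly connected weighted digraph on N nodes, and let ρ ∈ ℝ^N have all entries strictly positive with ρᵀL = 0 and ∑_i ρ_i = 1. Set R = diag(ρ₁,…,ρ_N) and L̄ = (R·L + Lᵀ·R)/2. Then L̄ is a symmetric positive semidefinite matrix, L̄·𝟏_N = 0, and every x ∈ ℝ^N with xᵀ·L̄·x = 0 is a scalar multiple of 𝟏_N; in other words, 0 is a simple eigenvalue of L̄ and all other eigenvalues of L̄ are strictly positive. -/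
open Matrix

section LaplacianLemmas

variable {ι : Type*} [Fintype ι] [DecidableEq ι]

theorem laplacian_mulVec_apply {a : ι → ι → ℝ} (ha : ∀ i, a i i = 0) {L : Matrix ι ι ℝ}
    (hL : ∀ i j, L i j = if i = j then ∑ k, a i k else -(a i j)) (x : ι → ℝ) (i : ι) :
    (L *ᵥ x) i = ∑ j, a i j * (x i - x j) := by
  have hentry : ∀ j, L i j * x j = (if i = j then (∑ k, a i k) * x j else 0) - a i j * x j := by
    intro j
    rw [hL]
    split_ifs with h
    · subst h
      simp [ha]
    · ring
  simp only [mulVec, dotProduct, hentry, Finset.sum_sub_distrib, Finset.sum_ite_eq,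
    Finset.mem_univ, if_true, mul_sub, Finset.sum_mul]

theorem dotProduct_symmetrization_mulVec (ρ : ι → ℝ) (L : Matrix ι ι ℝ) (x : ι → ℝ) :
    x ⬝ᵥ ((1 / 2 : ℝ) • (diagonal ρ * L + Lᵀ * diagonal ρ)) *ᵥ x =
      ∑ i, ρ i * (x i * (L *ᵥ x) i) := by
  have h : x ⬝ᵥ (Lᵀ * diagonal ρ) *ᵥ x = x ⬝ᵥ (diagonal ρ * L) *ᵥ x := by
    rw [dotProduct_mulVec, dotProduct_comm, ← mulVec_transpose, transpose_mul,
      transpose_transpose, diagonal_transpose]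
  rw [smul_mulVec, add_mulVec, dotProduct_smul, dotProduct_add, h, ← mulVec_mulVec]
  simp only [dotProduct, mulVec_diagonal, smul_eq_mul]
  rw [← two_mul, ← mul_assoc, one_div, inv_mul_cancel₀ two_ne_zero, one_mul]
  exact Finset.sum_congr rfl fun i _ => by ring

/-- The quadratic form of the symmetrized Laplacian is a weighted sum of squared differences. -/
theorem dotProduct_symmetrized_laplacian_mulVec {a : ι → ι → ℝ} (ha : ∀ i, a i i = 0)
    {L : Matrix ι ι ℝ} (hL : ∀ i j, L i j = if i = j then ∑ k, a i k else -(a i j))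
    {ρ : ι → ℝ} (hρL : ρ ᵥ* L = 0) (x : ι → ℝ) :
    x ⬝ᵥ ((1 / 2 : ℝ) • (diagonal ρ * L + Lᵀ * diagonal ρ)) *ᵥ x =
      1 / 2 * ∑ i, ∑ j, ρ i * a i j * (x i - x j) ^ 2 := by
  have hsq : ∑ i, ρ i * (L *ᵥ fun k => x k ^ 2) i = 0 := by
    change ρ ⬝ᵥ L *ᵥ (fun k => x k ^ 2) = 0
    rw [dotProduct_mulVec, hρL, zero_dotProduct]
  rw [dotProduct_symmetrization_mulVec]
  have hsplit : ∑ i, ρ i * (x i * (L *ᵥ x) i) =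
      1 / 2 * ∑ i, ∑ j, ρ i * a i j * (x i - x j) ^ 2 +
        1 / 2 * ∑ i, ρ i * (L *ᵥ fun k => x k ^ 2) i := by
    simp only [laplacian_mulVec_apply ha hL, Finset.mul_sum, ← Finset.sum_add_distrib]
    exact Finset.sum_congr rfl fun i _ => Finset.sum_congr rfl fun j _ => by ring
  rw [hsplit, hsq, mul_zero, add_zero]

end LaplacianLemmas

/-- For a strongly connected weighted digraph with Laplacian `L` and
positive normalized left eigenvector `ρ`, the matrix `L̄ = (R L + Lᵀ R)/2` with
`R = diag ρ` is symmetric positive semidefinite, annihilates the all-ones vector, and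
its quadratic form vanishes only on multiples of the all-ones vector (so `0` is a
simple eigenvalue of `L̄` and all other eigenvalues are strictly positive). -/
theorem symmetrized_laplacian_psd_simple_zero_eigenvalue
    (N : ℕ) (hN : 2 ≤ N) (a : Fin N → Fin N → ℝ)
    (ha_nonneg : ∀ i j, 0 ≤ a i j) (ha_diag : ∀ i, a i i = 0)
    (hconn : ∀ i j : Fin N, i ≠ j →
      Relation.TransGen (fun p q : Fin N => 0 < a q p) i j)
    (L : Matrix (Fin N) (Fin N) ℝ)
    (hL : ∀ i j, L i j = if i = j then ∑ k, a i k else -(a i j))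
    (ρ : Fin N → ℝ) (hρpos : ∀ i, 0 < ρ i)
    (hρL : Matrix.vecMul ρ L = 0) (hρsum : ∑ i, ρ i = 1)
    (R : Matrix (Fin N) (Fin N) ℝ) (hR : R = Matrix.diagonal ρ)
    (Lbar : Matrix (Fin N) (Fin N) ℝ)
    (hLbar : Lbar = (1 / 2 : ℝ) • (R * L + Lᵀ * R)) :
    Lbar.IsSymm ∧
    (∀ x : Fin N → ℝ, 0 ≤ x ⬝ᵥ Lbar.mulVec x) ∧
    Lbar.mulVec (fun _ => (1 : ℝ)) = 0 ∧
    (∀ x : Fin N → ℝ, x ⬝ᵥ Lbar.mulVec x = 0 → ∃ c : ℝ, x = fun _ => c) := by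
  subst hR hLbar
  have hform := dotProduct_symmetrized_laplacian_mulVec ha_diag hL hρL
  have hterm : ∀ (x : Fin N → ℝ) (i j : Fin N), 0 ≤ ρ i * a i j * (x i - x j) ^ 2 := fun x i j =>
    mul_nonneg (mul_nonneg (hρpos i).le (ha_nonneg i j)) (sq_nonneg _)
  have hrow : ∀ (x : Fin N → ℝ) (i : Fin N), 0 ≤ ∑ j, ρ i * a i j * (x i - x j) ^ 2 := fun x i =>
    Finset.sum_nonneg fun j _ => hterm x i j
  refine ⟨?_, fun x => ?_, ?_, fun x hx => ?_⟩
  · simp [IsSymm, transpose_add, transpose_mul, add_comm]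
  · rw [hform]
    exact mul_nonneg (by norm_num) (Finset.sum_nonneg fun i _ => hrow x i)
  · have hL1 : L *ᵥ (fun _ => (1 : ℝ)) = 0 := by
      ext i
      simp [laplacian_mulVec_apply ha_diag hL]
    have hR1 : diagonal ρ *ᵥ (fun _ => (1 : ℝ)) = ρ := by
      ext i
      simp [mulVec_diagonal]
    rw [smul_mulVec, add_mulVec, ← mulVec_mulVec, ← mulVec_mulVec, hL1, hR1, mulVec_transpose,
      hρL, mulVec_zero, add_zero, smul_zero]
  · rw [hform] at hx
    have hsum : ∑ i, ∑ j, ρ i * a i j * (x i - x j) ^ 2 = 0 := by linarith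
    have hedge : ∀ p q, 0 < a q p → x p = x q := by
      intro p q hpq
      have hq := (Finset.sum_eq_zero_iff_of_nonneg fun i _ => hrow x i).mp hsum q
        (Finset.mem_univ q)
      have hqp := (Finset.sum_eq_zero_iff_of_nonneg fun j _ => hterm x q j).mp hq p
        (Finset.mem_univ p)
      have hsq := (mul_eq_zero.mp hqp).resolve_left (mul_pos (hρpos q) hpq).ne'
      exact (sub_eq_zero.mp (pow_eq_zero_iff two_ne_zero |>.mp hsq)).symm
    have hpath : ∀ i j, Relation.TransGen (fun p q : Fin N => 0 < a q p) i j → x i = x j := by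
      intro i j h
      induction h with
      | single h => exact hedge _ _ h
      | tail _ h ih => exact ih.trans (hedge _ _ h)
    let i₀ : Fin N := ⟨0, by omega⟩
    refine ⟨x i₀, funext fun i => ?_⟩
    by_cases h : i = i₀
    · rw [h]
    · exact hpath i i₀ (hconn i i₀ h)
end

section
/- Consider the perturbed system ẋ = f(t,x) + g(t,x) on ℝⁿ. Assume: (1) f : ℝ × ℝⁿ → ℝⁿ is continuously differentiable, f(t,0) = 0 for all t, and its Jacobian with respect to x is bounded on ℝⁿ uniformly in t, i.e., there is M > 0 with ‖∂f/∂x(t,x)‖ ≤ M for all (t,x); (2) x = 0 is an exponentially stable equilibrium point of the nominal system ẋ = f(t,x), i.e., there exist k, λ, c > 0 such that every solution x(·) of ẋ = f(t,x) with ‖x(t₀)‖ ≤ c (t₀ ≥ 0) satisfies ‖x(t)‖ ≤ k·‖x(t₀)‖·e^{−λ(t−t₀)} for all t ≥ t₀; (3) g : ℝ × ℝⁿ → ℝⁿ is continuous, g(t,0) = 0 for all t, and there is a continuous function γ : [0,∞) → [0,∞) with γ(t) → 0 as t → ∞ such that ‖g(t,x)‖ ≤ γ(t)·‖x‖ for all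 (t,x). Then x = 0 is an exponentially stable equilibrium point of the perturbed system: there exist constants k', λ', c' > 0 such that every solution x(·) of ẋ = f(t,x) + g(t,x) with ‖x(t₀)‖ ≤ c' (t₀ ≥ 0) satisfies ‖x(t)‖ ≤ k'·‖x(t₀)‖·e^{−λ'(t−t₀)} for all t ≥ t₀. -/
open Filter

open Set Manifold in
/-- A `C¹` time-dependent vector field that vanishes at the origin and is Lipschitz in space,
uniformly in time, has a global solution through every initial condition. -/
theorem exists_forall_hasDerivAt_of_lipschitzWith {E : Type*} [NormedAddCommGroup E]
    [NormedSpace ℝ E] [CompleteSpace E] {f : ℝ → E → E}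
    (hf : ContDiff ℝ 1 (fun p : ℝ × E => f p.1 p.2)) (hf0 : ∀ t, f t 0 = 0)
    {K : NNReal} (hK : 0 < K) (hLip : ∀ t, LipschitzWith K (f t)) (s : ℝ) (x₀ : E) :
    ∃ y : ℝ → E, y s = x₀ ∧ ∀ t, HasDerivAt y (f t (y t)) t := by
  let v : (p : ℝ × E) → TangentSpace 𝓘(ℝ, ℝ × E) p := fun p => ((1 : ℝ), f p.1 p.2)
  have hv : ContMDiff 𝓘(ℝ, ℝ × E) 𝓘(ℝ, ℝ × E).tangent 1
      (fun p ↦ (⟨p, v p⟩ : TangentBundle 𝓘(ℝ, ℝ × E) (ℝ × E))) := by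
    rw [contMDiff_vectorSpace_iff_contDiff]
    exact contDiff_const.prodMk hf
  have hh : (0 : ℝ) < 1 / (2 * K) := by positivity
  set h : ℝ := 1 / (2 * K) with h_def
  have hloc : ∀ p : ℝ × E, ∃ c : ℝ → ℝ × E, c 0 = p ∧ IsMIntegralCurveOn c v (Ioo (-h) h) := by
    rintro ⟨r, z⟩
    have hmem : r ∈ Icc (r - h) (r + h) := ⟨by linarith, by linarith⟩
    have hPL : IsPicardLindelof f (⟨r, hmem⟩ : Icc (r - h) (r + h)) z ‖z‖₊ 0 (2 * K * ‖z‖₊) K := by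
      refine ⟨fun t _ => (hLip t).lipschitzOnWith, fun x _ => ?_, fun t _ x hx => ?_, ?_⟩
      · exact (hf.continuous.comp (Continuous.prodMk_left x)).continuousOn
      · have h1 : ‖f t x‖ ≤ K * ‖x‖ := by
          simpa [hf0, dist_eq_norm] using (hLip t).dist_le_mul x 0
        have h2 : ‖x‖ ≤ 2 * ‖z‖ := by
          have := norm_le_norm_add_norm_sub' x z
          have := mem_closedBall_iff_norm.1 hx
          rw [coe_nnnorm] at this
          linarith
        push_cast
        have := mul_le_mul_of_nonneg_left h2 K.coe_nonneg
        linarith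
      · have : (K : ℝ) ≠ 0 := by positivity
        simp only [add_sub_cancel_left, sub_sub_cancel, max_self, h_def]
        push_cast
        field_simp
        simp
    obtain ⟨α, hα0, hα⟩ := hPL.exists_eq_forall_mem_Icc_hasDerivWithinAt₀
    refine ⟨fun t => (r + t, α (r + t)), by simpa using hα0, fun t ht => ?_⟩
    have hd : HasDerivAt α (f (r + t) (α (r + t))) (r + t) :=
      (hα (r + t) ⟨by linarith [ht.1], by linarith [ht.2]⟩).hasDerivAt
        (Icc_mem_nhds (by linarith [ht.1]) (by linarith [ht.2]))
    have hadd : HasDerivAt (fun t => r + t) 1 t := (hasDerivAt_id t).const_add r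
    have := hadd.prodMk (hd.scomp t hadd)
    rw [one_smul] at this
    exact this.hasFDerivAt.hasFDerivWithinAt.hasMFDerivWithinAt
  obtain ⟨c, hc0, hc⟩ := exists_isMIntegralCurve_of_isMIntegralCurveOn hv hh hloc (s, x₀)
  have hcd : ∀ t, HasDerivAt c ((1 : ℝ), f (c t).1 (c t).2) t := fun t =>
    hasDerivAt_iff_hasFDerivAt.2 (hasMFDerivAt_iff_hasFDerivAt.1 (hc t))
  have h1 : ∀ t, HasDerivAt (fun t => (c t).1) 1 t := fun t => (hcd t).fst
  have h2 : ∀ t, HasDerivAt (fun t => (c t).2) (f (c t).1 (c t).2) t := fun t => (hcd t).snd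
  have hfst : ∀ t, (c t).1 = s + t := by
    intro t
    have hz : ∀ t, HasDerivAt (fun t => (c t).1 - t) 0 t := fun t => by
      have := (h1 t).sub (hasDerivAt_id t)
      rw [sub_self] at this
      exact this
    have := is_const_of_deriv_eq_zero (fun t => (hz t).differentiableAt)
      (fun t => (hz t).deriv) t 0
    simp only [hc0, sub_zero] at this
    linarith
  refine ⟨fun t => (c (t - s)).2, by simp [hc0], fun t => ?_⟩
  have := (h2 (t - s)).comp_sub_const t s
  rwa [hfst, add_sub_cancel] at this

open Real in
/-- A function with at most exponential growth that is halved over every time step of length `T`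
decays exponentially. -/
theorem le_mul_exp_of_halving {u : ℝ → ℝ} {a c L T : ℝ} (hL : 0 ≤ L) (hT : 0 < T)
    (hu : ∀ t, 0 ≤ u t)
    (hgrowth : ∀ s t, a ≤ s → s ≤ t → u t ≤ u s * exp (L * (t - s)))
    (hhalf : ∀ s, a ≤ s → u s ≤ c → u (s + T) ≤ u s / 2) (ha : u a ≤ c) {t : ℝ} (ht : a ≤ t) :
    u t ≤ 2 * exp (L * T) * u a * exp (-(log 2 / T) * (t - a)) := by
  have hstep : ∀ m : ℕ, u (a + m * T) ≤ u a * (1 / 2) ^ m := by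
    intro m
    induction m with
    | zero => simp
    | succ m ih =>
      have hle : u (a + m * T) ≤ c := ih.trans <| le_trans
        (mul_le_of_le_one_right (hu a) (pow_le_one₀ (by norm_num) (by norm_num))) ha
      have := hhalf (a + m * T) (le_add_of_nonneg_right (by positivity)) hle
      rw [pow_succ]
      push_cast
      rw [show a + ((m : ℝ) + 1) * T = a + m * T + T by ring]
      linarith
  set m := ⌊(t - a) / T⌋₊
  have hm1 : m * T ≤ t - a :=
    (le_div_iff₀ hT).1 (Nat.floor_le (div_nonneg (sub_nonneg.2 ht) hT.le))
  have hm2 : t - a ≤ (m + 1) * T := (div_le_iff₀ hT).1 (Nat.lt_floor_add_one _).le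
  have hexp : (1 / 2 : ℝ) ^ m ≤ 2 * exp (-(log 2 / T) * (t - a)) := by
    have h1 : exp (-(log 2 * (m + 1))) ≤ exp (-(log 2 / T) * (t - a)) := by
      apply exp_le_exp.2
      have := mul_le_mul_of_nonneg_left hm2 (div_nonneg (log_nonneg one_le_two) hT.le)
      have h3 : log 2 / T * ((m + 1) * T) = log 2 * (m + 1) := by field_simp
      linarith
    have h2 : exp (-(log 2 * (m + 1))) = (1 / 2) ^ m / 2 := by
      rw [exp_neg, mul_comm, ← Nat.cast_succ, exp_nat_mul, exp_log two_pos, pow_succ, mul_inv, one_div,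
        inv_pow, div_eq_mul_inv]
    linarith
  calc u t ≤ u (a + m * T) * exp (L * (t - (a + m * T))) :=
        hgrowth _ _ (le_add_of_nonneg_right (by positivity)) (by linarith)
    _ ≤ (u a * (1 / 2) ^ m) * exp (L * T) := by
        have := hu a
        gcongr
        · exact hstep m
        · linarith
    _ ≤ (u a * (2 * exp (-(log 2 / T) * (t - a)))) * exp (L * T) := by
        have := hu a
        gcongr
    _ = _ := by ring

/-- Grönwall estimate on `[s, t]` for an inhomogeneous linear differential inequality. -/
theorem norm_le_gronwallBound_of_hasDerivAt {E : Type*} [NormedAddCommGroup E] [NormedSpace ℝ E]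
    {x x' : ℝ → E} {K δ s t : ℝ} (hst : s ≤ t)
    (hx : ∀ r, s ≤ r → HasDerivAt x (x' r) r)
    (hx' : ∀ r, s ≤ r → r ≤ t → ‖x' r‖ ≤ K * ‖x r‖ + δ) :
    ‖x t‖ ≤ gronwallBound ‖x s‖ K δ (t - s) :=
  norm_le_gronwallBound_of_norm_deriv_right_le (b := t)
    (fun r hr => (hx r hr.1).continuousAt.continuousWithinAt)
    (fun r hr => (hx r hr.1).hasDerivWithinAt) le_rfl (fun r hr => hx' r hr.1 hr.2.le) t
    ⟨hst, le_rfl⟩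

/-- Lemma 2 of the paper. If the origin is an exponentially stable
equilibrium of the nominal system `ẋ = f(t,x)`, where `f` is continuously
differentiable with a uniformly bounded Jacobian, and the perturbation `g` is
continuous, vanishes at the origin, and satisfies `‖g(t,x)‖ ≤ γ(t)‖x‖` with
`γ(t) → 0`, then the origin is an exponentially stable equilibrium of the perturbed
system `ẋ = f(t,x) + g(t,x)`. -/
theorem perturbed_system_exponentially_stable
    (n : ℕ) (hn : 1 ≤ n)
    (f g : ℝ → EuclideanSpace ℝ (Fin n) → EuclideanSpace ℝ (Fin n))
    (hf_smooth : ContDiff ℝ 1 (fun p : ℝ × EuclideanSpace ℝ (Fin n) => f p.1 p.2))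
    (hf0 : ∀ t : ℝ, f t 0 = 0)
    (M : ℝ) (hM : 0 < M)
    (hJac : ∀ (t : ℝ) (x : EuclideanSpace ℝ (Fin n)), ‖fderiv ℝ (f t) x‖ ≤ M)
    (k lam c : ℝ) (hk : 0 < k) (hlam : 0 < lam) (hc : 0 < c)
    (hstab : ∀ t₀ : ℝ, 0 ≤ t₀ → ∀ x : ℝ → EuclideanSpace ℝ (Fin n),
      (∀ t, t₀ ≤ t → HasDerivAt x (f t (x t)) t) → ‖x t₀‖ ≤ c →
      ∀ t, t₀ ≤ t → ‖x t‖ ≤ k * ‖x t₀‖ * Real.exp (-lam * (t - t₀)))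
    (hg_cont : Continuous (fun p : ℝ × EuclideanSpace ℝ (Fin n) => g p.1 p.2))
    (hg0 : ∀ t : ℝ, g t 0 = 0)
    (γ : ℝ → ℝ) (hγ_cont : Continuous γ) (hγ_nonneg : ∀ t, 0 ≤ γ t)
    (hγ_lim : Tendsto γ atTop (nhds 0))
    (hg_bound : ∀ (t : ℝ) (x : EuclideanSpace ℝ (Fin n)), ‖g t x‖ ≤ γ t * ‖x‖) :
    ∃ k' lam' c' : ℝ, 0 < k' ∧ 0 < lam' ∧ 0 < c' ∧
      ∀ t₀ : ℝ, 0 ≤ t₀ → ∀ x : ℝ → EuclideanSpace ℝ (Fin n),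
        (∀ t, t₀ ≤ t → HasDerivAt x (f t (x t) + g t (x t)) t) → ‖x t₀‖ ≤ c' →
        ∀ t, t₀ ≤ t → ‖x t‖ ≤ k' * ‖x t₀‖ * Real.exp (-lam' * (t - t₀)) := by
  have hLip : ∀ t, LipschitzWith ⟨M, hM.le⟩ (f t) := fun t =>
    lipschitzWith_of_nnnorm_fderiv_le (𝕜 := ℝ)
      ((hf_smooth.comp (contDiff_prodMk_right t)).differentiable one_ne_zero) (hJac t)
  have hfM : ∀ t x y, ‖f t x - f t y‖ ≤ M * ‖x - y‖ := fun t x y => by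
    have := (hLip t).dist_le_mul x y
    rwa [dist_eq_norm, dist_eq_norm] at this
  obtain ⟨G, hG⟩ : ∃ G : ℝ, ∀ t, 0 ≤ t → γ t ≤ G := by
    obtain ⟨S, hS⟩ := eventually_atTop.1 (hγ_lim.eventually_le_const one_pos)
    obtain ⟨B, hB⟩ := (isCompact_Icc (a := 0) (b := S)).bddAbove_image hγ_cont.continuousOn
    refine ⟨max 1 B, fun t ht => ?_⟩
    rcases le_total S t with h | h
    · exact (hS t h).trans (le_max_left _ _)
    · exact (hB ⟨t, ⟨ht, h⟩, rfl⟩).trans (le_max_right _ _)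
  have hG0 : 0 ≤ G := (hγ_nonneg 0).trans (hG 0 le_rfl)
  set L := M + G with hL_def
  have hL : 0 < L := by positivity
  set T := 4 * k / lam with hT_def
  have hT : 0 < T := by positivity
  have hkT : k * Real.exp (-lam * T) ≤ 1 / 4 := by
    have h1 : -lam * T = -(4 * k) := by rw [hT_def]; field_simp
    rw [h1, Real.exp_neg, ← div_eq_mul_inv, div_le_iff₀ (Real.exp_pos _)]
    linarith [Real.add_one_le_exp (4 * k)]
  set ε := M / (4 * Real.exp (L * T) * Real.exp (M * T)) with hε_def
  have hε : 0 < ε := by positivity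
  obtain ⟨S, hS0, hS⟩ : ∃ S : ℝ, 0 ≤ S ∧ ∀ t, S ≤ t → γ t ≤ ε := by
    obtain ⟨S, hS⟩ := eventually_atTop.1 (hγ_lim.eventually_le_const hε)
    exact ⟨max S 0, le_max_right _ _, fun t ht => hS t ((le_max_left _ _).trans ht)⟩
  have hμ : 0 < Real.log 2 / T := div_pos (Real.log_pos one_lt_two) hT
  set μ := Real.log 2 / T
  refine ⟨2 * Real.exp (L * T) * Real.exp (L * S) * Real.exp (μ * S), μ,
    c * Real.exp (-(L * S)), by positivity, hμ, by positivity, fun t₀ ht₀ x hx hx0 t ht => ?_⟩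
  have hgrowth : ∀ s t, t₀ ≤ s → s ≤ t → ‖x t‖ ≤ ‖x s‖ * Real.exp (L * (t - s)) := by
    intro s t hs hst
    rw [← gronwallBound_ε0]
    refine norm_le_gronwallBound_of_hasDerivAt hst (fun r hr => hx r (hs.trans hr))
      fun r hr _ => (norm_add_le _ _).trans ?_
    have h1 : ‖f r (x r)‖ ≤ M * ‖x r‖ := by simpa [hf0] using hfM r (x r) 0
    have h2 : ‖g r (x r)‖ ≤ G * ‖x r‖ := (hg_bound r (x r)).trans <|
      mul_le_mul_of_nonneg_right (hG r (by linarith)) (norm_nonneg _)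
    rw [hL_def]
    linarith
  have hhalf : ∀ s, t₀ + S ≤ s → ‖x s‖ ≤ c → ‖x (s + T)‖ ≤ ‖x s‖ / 2 := by
    intro s hs hxs
    obtain ⟨y, hys, hy⟩ :=
      exists_forall_hasDerivAt_of_lipschitzWith hf_smooth hf0 (K := ⟨M, hM.le⟩) hM hLip s (x s)
    have hyT : ‖y (s + T)‖ ≤ ‖x s‖ / 4 := by
      have h1 := hstab s (by linarith) y (fun r _ => hy r) (hys ▸ hxs) (s + T) (by linarith)
      rw [hys, add_sub_cancel_left] at h1
      have := mul_le_mul_of_nonneg_right hkT (norm_nonneg (x s))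
      linarith
    have hxy : ‖x (s + T) - y (s + T)‖ ≤ ‖x s‖ / 4 := by
      have h1 : ‖x (s + T) - y (s + T)‖ ≤ gronwallBound ‖x s - y s‖ M
          (ε * (‖x s‖ * Real.exp (L * T))) (s + T - s) := by
        refine norm_le_gronwallBound_of_hasDerivAt (x := fun r => x r - y r) (by linarith)
          (fun r hr => (hx r (by linarith)).sub (hy r)) fun r hr hrT => ?_
        rw [add_sub_right_comm]
        refine (norm_add_le _ _).trans (add_le_add (hfM r _ _) ?_)
        have h2 : ‖x r‖ ≤ ‖x s‖ * Real.exp (L * T) := by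
          refine (hgrowth s r (by linarith) hr).trans ?_
          gcongr
          linarith
        exact (hg_bound r _).trans (mul_le_mul (hS r (by linarith)) h2 (norm_nonneg _) hε.le)
      rw [hys, sub_self, norm_zero, gronwallBound_of_K_ne_0 hM.ne', add_sub_cancel_left] at h1
      refine h1.trans ?_
      have h3 : ε * (‖x s‖ * Real.exp (L * T)) / M = ‖x s‖ / 4 / Real.exp (M * T) := by
        rw [hε_def]
        field_simp
      beta_reduce
      rw [zero_mul, zero_add, h3, div_mul_eq_mul_div, div_le_iff₀ (Real.exp_pos _)]
      gcongr
      linarith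
    have := norm_le_norm_add_norm_sub' (x (s + T)) (y (s + T))
    linarith
  have hxS : ‖x (t₀ + S)‖ ≤ ‖x t₀‖ * Real.exp (L * S) := by
    simpa using hgrowth t₀ (t₀ + S) le_rfl (by linarith)
  have hexp : Real.exp (μ * S) * Real.exp (-μ * (t - t₀)) =
      Real.exp (-μ * (t - (t₀ + S))) := by
    rw [← Real.exp_add]
    ring_nf
  have hrhs : 2 * Real.exp (L * T) * Real.exp (L * S) * Real.exp (μ * S) * ‖x t₀‖ *
      Real.exp (-μ * (t - t₀)) = 2 * Real.exp (L * T) * (‖x t₀‖ * Real.exp (L * S)) *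
        Real.exp (-μ * (t - (t₀ + S))) := by
    rw [← hexp]
    ring
  rw [hrhs]
  rcases le_total (t₀ + S) t with h | h
  · have hxc : ‖x (t₀ + S)‖ ≤ c := by
      refine hxS.trans ?_
      rw [Real.exp_neg] at hx0
      rwa [← le_div_iff₀ (Real.exp_pos _), div_eq_mul_inv]
    refine (le_mul_exp_of_halving (u := fun r => ‖x r‖) hL.le hT (fun _ => norm_nonneg _)
      (fun s r hs hr => hgrowth s r (by linarith) hr) hhalf hxc h).trans ?_
    gcongr
  · have h1 : ‖x t‖ ≤ ‖x t₀‖ * Real.exp (L * S) := by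
      refine (hgrowth t₀ t le_rfl ht).trans ?_
      gcongr
      linarith
    have h2 : 1 ≤ Real.exp (L * T) := Real.one_le_exp (by positivity)
    have h3 : 1 ≤ Real.exp (-μ * (t - (t₀ + S))) :=
      Real.one_le_exp (mul_nonneg_of_nonpos_of_nonpos (by linarith) (by linarith))
    refine h1.trans ?_
    have h4 : 1 ≤ 2 * Real.exp (L * T) * Real.exp (-μ * (t - (t₀ + S))) :=
      one_le_mul_of_one_le_of_one_le (by linarith) h3
    have := le_mul_of_one_le_left
      (mul_nonneg (norm_nonneg (x t₀)) (Real.exp_pos (L * S)).le) h4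
    linarith
end

section
/- Let L be the Laplacian of a strongly connected weighted digraph on N ≥ 2 nodes, let ρ ∈ ℝ^N have all entries strictly positive with ρᵀL = 0 and ∑_i ρ_i = 1, set R = diag(ρ₁,…,ρ_N), L̄ = (R·L + Lᵀ·R)/2, and ρ̲ = min_i ρ_i. Let c₁,…,c_N satisfy Assumption 1, and put ϖ = min_i ϖ_i and ῑ = max_i ι_i. Let λ₂ > 0 be a constant such that xᵀ·L̄·x ≥ λ₂·‖x − ((𝟏_Nᵀx)/N)·𝟏_N‖² for all x ∈ ℝ^N. Suppose δ, β₁, β₂ > 0 satisfy 2ϖ − ῑ²/(4δ) > 0, β₂·ρ̲ − 2δ > 0 and β₁·λ₂ − β₂²/δ > 0, and set μ₀ = min{2ϖ − ῑ²/(4δ), β₂·ρ̲ − 2δ}. Then for every s ∈ ℝ and every ỹ, z̃ ∈ ℝ^N with ρᵀ·z̃ = 0, writing Δ ∈ ℝ^N for the vector with components Δ_i = c_i'(ỹ_i + s) − c_i'(s), the following dissipation inequality holds: −2·ỹᵀΔ − β₁·ỹᵀ(R·L)ỹ − 2β₂·ỹᵀR·z̃ − z̃ᵀΔ − β₂·z̃ᵀR·z̃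 ≤ −μ₀·(‖ỹ‖² + ‖z̃‖²). -/
open Matrix

/-- A matrix and its symmetric part define the same quadratic form. -/
theorem dotProduct_symmPart_mulVec {n : Type*} [Fintype n] (M : Matrix n n ℝ) (x : n → ℝ) :
    x ⬝ᵥ ((1 / 2 : ℝ) • (M + Mᵀ)).mulVec x = x ⬝ᵥ M.mulVec x := by
  have h : x ⬝ᵥ Mᵀ.mulVec x = x ⬝ᵥ M.mulVec x := by
    rw [Matrix.mulVec_transpose, dotProduct_comm, ← Matrix.dotProduct_mulVec]
  rw [Matrix.smul_mulVec, Matrix.add_mulVec, dotProduct_smul, dotProduct_add, h, smul_eq_mul]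
  ring

/-- The scalar completion-of-squares estimate behind the dissipation inequality. -/
theorem scalar_dissipation_le {y z e d r w l r₀ δ β : ℝ} (hδ : 0 < δ) (hβ : 0 < β)
    (hr₀ : 0 ≤ r) (hr₁ : r ≤ 1) (hr : r₀ ≤ r) (hw : w * y ^ 2 ≤ y * d)
    (hl : d ^ 2 ≤ l ^ 2 * y ^ 2) :
    -2 * (y * d) - β ^ 2 / δ * e ^ 2 - 2 * β * (r * e * z) - z * d - β * (r * z ^ 2)
      ≤ -(2 * w - l ^ 2 / (4 * δ)) * y ^ 2 - (β * r₀ - 2 * δ) * z ^ 2 := by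
  have hz : β * r₀ * z ^ 2 ≤ β * r * z ^ 2 := by gcongr
  have hd : d ^ 2 / (4 * δ) ≤ l ^ 2 / (4 * δ) * y ^ 2 := by
    rw [div_mul_eq_mul_div]
    gcongr
  have hzd : 0 ≤ δ * z ^ 2 + z * d + d ^ 2 / (4 * δ) := by
    have : δ * z ^ 2 + z * d + d ^ 2 / (4 * δ) = (2 * δ * z + d) ^ 2 / (4 * δ) := by
      field_simp
      ring
    rw [this]
    positivity
  have hez : 0 ≤ δ * z ^ 2 + 2 * β * (r * e * z) + β ^ 2 / δ * e ^ 2 := by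
    have h : δ * z ^ 2 + 2 * β * (r * e * z) + β ^ 2 / δ * e ^ 2
        = ((δ * z + β * r * e) ^ 2 + β ^ 2 * (1 - r ^ 2) * e ^ 2) / δ := by
      field_simp
      ring
    have hr2 : 0 ≤ 1 - r ^ 2 := by nlinarith
    rw [h]
    positivity
  linarith

/-- The dissipation inequality from the proof of Theorem 1: with
`ϖ = min_i ϖ_i`, `ῑ = max_i ι_i`, `ρ̲ = min_i ρ_i`, suitable `δ, β₁, β₂` and
`μ₀ = min {2ϖ - ῑ²/(4δ), β₂ ρ̲ - 2δ}`, for every `s`, `ỹ` and every `z̃` with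
`ρᵀ z̃ = 0` one has
`-2 ỹᵀΔ - β₁ ỹᵀ(R L)ỹ - 2β₂ ỹᵀR z̃ - z̃ᵀΔ - β₂ z̃ᵀR z̃ ≤ -μ₀ (‖ỹ‖² + ‖z̃‖²)`,
where `Δ_i = c_i'(ỹ_i + s) - c_i'(s)`. -/
theorem coordinator_dissipation_inequality
    (N : ℕ) (hN : 2 ≤ N) (a : Fin N → Fin N → ℝ)
    (ha_nonneg : ∀ i j, 0 ≤ a i j) (ha_diag : ∀ i, a i i = 0)
    (hconn : ∀ i j : Fin N, i ≠ j →
      Relation.TransGen (fun p q : Fin N => 0 < a q p) i j)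
    (L : Matrix (Fin N) (Fin N) ℝ)
    (hL : ∀ i j, L i j = if i = j then ∑ k, a i k else -(a i j))
    (ρ : Fin N → ℝ) (hρpos : ∀ i, 0 < ρ i)
    (hρL : Matrix.vecMul ρ L = 0) (hρsum : ∑ i, ρ i = 1)
    (R : Matrix (Fin N) (Fin N) ℝ) (hR : R = Matrix.diagonal ρ)
    (Lbar : Matrix (Fin N) (Fin N) ℝ)
    (hLbar : Lbar = (1 / 2 : ℝ) • (R * L + Lᵀ * R))
    (ρlb : ℝ) (hρlb : IsLeast (Set.range ρ) ρlb)
    (c c' : Fin N → ℝ → ℝ)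
    (hderiv : ∀ (i : Fin N) (x : ℝ), HasDerivAt (c i) (c' i x) x)
    (ϖ ι : Fin N → ℝ) (hϖ : ∀ i, 0 < ϖ i) (hι : ∀ i, 0 < ι i)
    (hconv : ∀ (i : Fin N) (x y : ℝ),
      ϖ i * (x - y) ^ 2 ≤ (x - y) * (c' i x - c' i y))
    (hlip : ∀ (i : Fin N) (x y : ℝ), |c' i x - c' i y| ≤ ι i * |x - y|)
    (ϖ₀ : ℝ) (hϖ₀ : IsLeast (Set.range ϖ) ϖ₀)
    (ι₀ : ℝ) (hι₀ : IsGreatest (Set.range ι) ι₀)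
    (lam₂ : ℝ) (hlam₂pos : 0 < lam₂)
    (hlam₂ : ∀ x : Fin N → ℝ,
      lam₂ * ∑ i, (x i - (∑ j, x j) / N) ^ 2 ≤ x ⬝ᵥ Lbar.mulVec x)
    (δ β₁ β₂ : ℝ) (hδ : 0 < δ) (hβ₁ : 0 < β₁) (hβ₂ : 0 < β₂)
    (hcond₁ : 0 < 2 * ϖ₀ - ι₀ ^ 2 / (4 * δ))
    (hcond₂ : 0 < β₂ * ρlb - 2 * δ)
    (hcond₃ : 0 < β₁ * lam₂ - β₂ ^ 2 / δ)
    (μ₀ : ℝ) (hμ₀ : μ₀ = min (2 * ϖ₀ - ι₀ ^ 2 / (4 * δ)) (β₂ * ρlb - 2 * δ)) :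
    ∀ (s : ℝ) (ytil ztil : Fin N → ℝ), ∑ i, ρ i * ztil i = 0 →
      ∀ Δ : Fin N → ℝ, (∀ i, Δ i = c' i (ytil i + s) - c' i s) →
        -2 * (ytil ⬝ᵥ Δ) - β₁ * (ytil ⬝ᵥ (R * L).mulVec ytil)
            - 2 * β₂ * (ytil ⬝ᵥ R.mulVec ztil) - (ztil ⬝ᵥ Δ)
            - β₂ * (ztil ⬝ᵥ R.mulVec ztil)
          ≤ -μ₀ * (∑ i, ytil i ^ 2 + ∑ i, ztil i ^ 2) := by
  intro s y z hz Δ hΔ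
  obtain ⟨hρlb, hϖ₀, hι₀⟩ :
      (∀ i, ρlb ≤ ρ i) ∧ (∀ i, ϖ₀ ≤ ϖ i) ∧ (∀ i, ι i ≤ ι₀) :=
    ⟨fun i => hρlb.2 ⟨i, rfl⟩, fun i => hϖ₀.2 ⟨i, rfl⟩, fun i => hι₀.2 ⟨i, rfl⟩⟩
  have hρ1 : ∀ i, ρ i ≤ 1 := fun i =>
    hρsum ▸ Finset.single_le_sum (fun j _ => (hρpos j).le) (Finset.mem_univ i)
  set m := (∑ j, y j) / N with hm
  have hquad : β₂ ^ 2 / δ * ∑ i, (y i - m) ^ 2 ≤ β₁ * (y ⬝ᵥ (R * L).mulVec y) := by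
    have hsymm : Lbar = (1 / 2 : ℝ) • (R * L + (R * L)ᵀ) := by
      rw [hLbar, Matrix.transpose_mul, hR, Matrix.diagonal_transpose]
    have h := hlam₂ y
    rw [hsymm, dotProduct_symmPart_mulVec] at h
    calc β₂ ^ 2 / δ * ∑ i, (y i - m) ^ 2
        ≤ β₁ * lam₂ * ∑ i, (y i - m) ^ 2 := by gcongr; linarith
      _ ≤ β₁ * (y ⬝ᵥ (R * L).mulVec y) := by
          rw [mul_assoc]
          gcongr
  have hyz : y ⬝ᵥ R.mulVec z = ∑ i, ρ i * (y i - m) * z i := by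
    have : ∑ i, ρ i * (y i - m) * z i = ∑ i, y i * (ρ i * z i) - m * ∑ i, ρ i * z i := by
      rw [Finset.mul_sum, ← Finset.sum_sub_distrib]
      exact Finset.sum_congr rfl fun i _ => by ring
    simp [this, hz, hR, dotProduct, Matrix.mulVec_diagonal]
  have hzz : z ⬝ᵥ R.mulVec z = ∑ i, ρ i * z i ^ 2 := by
    simp only [hR, dotProduct, Matrix.mulVec_diagonal]
    exact Finset.sum_congr rfl fun i _ => by ring
  have hpt : ∀ i, -2 * (y i * Δ i) - β₂ ^ 2 / δ * (y i - m) ^ 2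
      - 2 * β₂ * (ρ i * (y i - m) * z i) - z i * Δ i - β₂ * (ρ i * z i ^ 2)
      ≤ -(2 * ϖ₀ - ι₀ ^ 2 / (4 * δ)) * y i ^ 2 - (β₂ * ρlb - 2 * δ) * z i ^ 2 := by
    intro i
    have hc := hconv i (y i + s) s
    have hl := hlip i (y i + s) s
    rw [add_sub_cancel_right, ← hΔ] at hc hl
    refine scalar_dissipation_le hδ hβ₂ (hρpos i).le (hρ1 i) (hρlb i) ?_ ?_
    · exact (mul_le_mul_of_nonneg_right (hϖ₀ i) (sq_nonneg _)).trans hc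
    · have hl' : |Δ i| ≤ ι₀ * |y i| :=
        hl.trans (mul_le_mul_of_nonneg_right (hι₀ i) (abs_nonneg _))
      simpa only [sq_abs, mul_pow] using pow_le_pow_left₀ (abs_nonneg _) hl' 2
  have hsum := Finset.sum_le_sum fun i (_ : i ∈ Finset.univ) => hpt i
  simp only [Finset.sum_sub_distrib, ← Finset.mul_sum] at hsum
  have hμy : μ₀ * ∑ i, y i ^ 2 ≤ (2 * ϖ₀ - ι₀ ^ 2 / (4 * δ)) * ∑ i, y i ^ 2 := by
    gcongr
    exact hμ₀ ▸ min_le_left _ _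
  have hμz : μ₀ * ∑ i, z i ^ 2 ≤ (β₂ * ρlb - 2 * δ) * ∑ i, z i ^ 2 := by
    gcongr
    exact hμ₀ ▸ min_le_right _ _
  rw [hyz, hzz]
  simp only [dotProduct] at hquad ⊢
  linarith
end

section
/- Let L be the Laplacian of a strongly connected weighted digraph on N ≥ 2 nodes, let ρ ∈ ℝ^N have all entries strictly positive with ρᵀL = 0 and ∑_i ρ_i = 1, set R = diag(ρ₁,…,ρ_N), L̄ = (R·L + Lᵀ·R)/2, ρ̲ = min_i ρ_i. Let c₁,…,c_N satisfy Assumption 1 with ϖ = min_i ϖ_i and ῑ = max_i ι_i, and let λ₂ > 0 satisfy xᵀ·L̄·x ≥ λ₂·‖x − ((𝟏_Nᵀx)/N)·𝟏_N‖² for all x ∈ ℝ^N. Suppose δ, β₁, β₂ > 0 satisfy 2ϖ − ῑ²/(4δ) > 0, β₂·ρ̲ − 2δ > 0 and β₁·λ₂ − β₂²/δ > 0. Fix s ∈ ℝ and define Δ : ℝ^N → ℝ^N by Δ(y)_i = c_i'(y_i + s) − c_i'(s). Let ỹ, z̃ : [0,∞) → ℝ^N be differentiable functions satisfying, for all t ≥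 0, ỹ'(t) = −R⁻¹·Δ(ỹ(t)) − β₁·L·ỹ(t) − β₂·z̃(t) and z̃'(t) = β₁·L·ỹ(t), with ρᵀ·z̃(0) = 0. Then the origin is globally exponentially attractive for this system: there exist constants k ≥ 1 and μ > 0, depending only on L, ρ, the ϖ_i, ι_i, δ, β₁, β₂ (not on the initial condition), such that ‖ỹ(t)‖² + ‖z̃(t)‖² ≤ k·(‖ỹ(0)‖² + ‖z̃(0)‖²)·e^{−μ t} for all t ≥ 0. -/
open Matrix

/-- Grönwall: a function with `V' ≤ -μ V` on `[0, ∞)` decays exponentially. -/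
theorem le_mul_exp_of_hasDerivAt_le_s11 {V V' : ℝ → ℝ} {μ : ℝ}
    (hV : ∀ t, 0 ≤ t → HasDerivAt V (V' t) t) (hle : ∀ t, 0 ≤ t → V' t ≤ -μ * V t)
    {t : ℝ} (ht : 0 ≤ t) : V t ≤ V 0 * Real.exp (-μ * t) := by
  have hd : ∀ τ, 0 ≤ τ → HasDerivAt (fun τ => V τ * Real.exp (μ * τ))
      (V' τ * Real.exp (μ * τ) + V τ * (Real.exp (μ * τ) * (μ * 1))) τ := fun τ hτ =>
    (hV τ hτ).mul (((hasDerivAt_id τ).const_mul μ).exp)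
  have hanti : AntitoneOn (fun τ => V τ * Real.exp (μ * τ)) (Set.Ici 0) := by
    refine antitoneOn_of_deriv_nonpos (convex_Ici 0)
      (fun τ hτ => (hd τ hτ).continuousAt.continuousWithinAt)
      (fun τ hτ => ?_) (fun τ hτ => ?_)
    · exact (hd τ (interior_subset hτ)).differentiableAt.differentiableWithinAt
    · rw [(hd τ (interior_subset hτ)).deriv]
      nlinarith [hle τ (interior_subset hτ), Real.exp_pos (μ * τ)]
  have h := hanti Set.self_mem_Ici ht ht
  simp only [mul_zero, Real.exp_zero, mul_one] at h
  calc V t = V t * Real.exp (μ * t) * Real.exp (-μ * t) := by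
        rw [mul_assoc, ← Real.exp_add]; simp
    _ ≤ V 0 * Real.exp (-μ * t) := by gcongr

theorem dotProduct_symmPart_mulVec_s11 {n : Type*} [Fintype n] [DecidableEq n]
    (ρ : n → ℝ) (L : Matrix n n ℝ) (x : n → ℝ) :
    x ⬝ᵥ ((1 / 2 : ℝ) • (diagonal ρ * L + Lᵀ * diagonal ρ)) *ᵥ x
      = ∑ i, ρ i * x i * (L *ᵥ x) i := by
  have h₁ : x ⬝ᵥ (diagonal ρ * L) *ᵥ x = ∑ i, ρ i * x i * (L *ᵥ x) i := by
    rw [← mulVec_mulVec]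
    simp only [dotProduct, mulVec_diagonal]
    exact Finset.sum_congr rfl fun i _ => by ring
  have h₂ : x ⬝ᵥ (Lᵀ * diagonal ρ) *ᵥ x = ∑ i, ρ i * x i * (L *ᵥ x) i := by
    rw [← mulVec_mulVec, dotProduct_mulVec, vecMul_transpose]
    simp only [dotProduct, mulVec_diagonal]
    exact Finset.sum_congr rfl fun i _ => by ring
  rw [smul_mulVec, add_mulVec, dotProduct_smul, dotProduct_add, h₁, h₂, smul_eq_mul]
  ring

/-- Coordinatewise dissipation estimate, by completing squares in the two cross terms. -/
theorem dissipation_coord_le {y z D m r ϖ ϖ₀ ι ι₀ rlb δ β : ℝ} (hδ : 0 < δ) (hβ : 0 < β)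
    (hrpos : 0 < r) (hr : r ≤ 1) (hrlb : rlb ≤ r) (hϖ : ϖ₀ ≤ ϖ) (hι₀ : ι ≤ ι₀)
    (hconv : ϖ * y ^ 2 ≤ y * D) (hlip : |D| ≤ ι * |y|) :
    -2 * (y * D) - z * D - 2 * β * (r * (y - m) * z) - β * r * z ^ 2
      ≤ -(2 * ϖ₀ - ι₀ ^ 2 / (4 * δ)) * y ^ 2 - (β * rlb - 2 * δ) * z ^ 2
        + β ^ 2 / δ * (y - m) ^ 2 := by
  have hD : D ^ 2 ≤ ι₀ ^ 2 * y ^ 2 := by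
    rw [← sq_abs D, ← sq_abs y, ← mul_pow]
    exact pow_le_pow_left₀ (abs_nonneg _)
      (hlip.trans (mul_le_mul_of_nonneg_right hι₀ (abs_nonneg _))) 2
  have h₁ : -(z * D) ≤ δ * z ^ 2 + ι₀ ^ 2 / (4 * δ) * y ^ 2 := by
    have e : δ * z ^ 2 + D ^ 2 / (4 * δ) + z * D = (2 * δ * z + D) ^ 2 / (4 * δ) := by
      field_simp; ring
    have h : 0 ≤ (2 * δ * z + D) ^ 2 / (4 * δ) := by positivity
    have h' : D ^ 2 / (4 * δ) ≤ ι₀ ^ 2 * y ^ 2 / (4 * δ) := by gcongr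
    rw [div_mul_eq_mul_div]
    linarith
  have h₂ : -(2 * β * (r * (y - m) * z)) ≤ δ * z ^ 2 + β ^ 2 / δ * (y - m) ^ 2 := by
    have e : δ * (r * z) ^ 2 + β ^ 2 / δ * (y - m) ^ 2 + 2 * β * (r * (y - m) * z)
        = (δ * (r * z) + β * (y - m)) ^ 2 / δ := by
      field_simp; ring
    have h : 0 ≤ (δ * (r * z) + β * (y - m)) ^ 2 / δ := by positivity
    have h' : δ * (r * z) ^ 2 ≤ δ * z ^ 2 := by
      rw [mul_pow]
      exact mul_le_mul_of_nonneg_left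
        (mul_le_of_le_one_left (sq_nonneg z) (pow_le_one₀ hrpos.le hr)) hδ.le
    linarith
  have h₃ : ϖ₀ * y ^ 2 ≤ ϖ * y ^ 2 := by gcongr
  have h₄ : β * rlb * z ^ 2 ≤ β * r * z ^ 2 := by gcongr
  linarith

/-- Global exponential stability of the origin for the translated
coordinator error dynamics
`ỹ' = -R⁻¹ Δ(ỹ) - β₁ L ỹ - β₂ z̃`, `z̃' = β₁ L ỹ`, with `ρᵀ z̃(0) = 0`:
there exist `k ≥ 1` and `μ > 0`, independent of the initial condition, such that
`‖ỹ(t)‖² + ‖z̃(t)‖² ≤ k (‖ỹ(0)‖² + ‖z̃(0)‖²) e^{-μ t}` for all `t ≥ 0`. -/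
theorem coordinator_error_dynamics_exponentially_stable
    (N : ℕ) (hN : 2 ≤ N) (a : Fin N → Fin N → ℝ)
    (ha_nonneg : ∀ i j, 0 ≤ a i j) (ha_diag : ∀ i, a i i = 0)
    (hconn : ∀ i j : Fin N, i ≠ j →
      Relation.TransGen (fun p q : Fin N => 0 < a q p) i j)
    (L : Matrix (Fin N) (Fin N) ℝ)
    (hL : ∀ i j, L i j = if i = j then ∑ k, a i k else -(a i j))
    (ρ : Fin N → ℝ) (hρpos : ∀ i, 0 < ρ i)
    (hρL : Matrix.vecMul ρ L = 0) (hρsum : ∑ i, ρ i = 1)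
    (R : Matrix (Fin N) (Fin N) ℝ) (hR : R = Matrix.diagonal ρ)
    (Lbar : Matrix (Fin N) (Fin N) ℝ)
    (hLbar : Lbar = (1 / 2 : ℝ) • (R * L + Lᵀ * R))
    (ρlb : ℝ) (hρlb : IsLeast (Set.range ρ) ρlb)
    (c c' : Fin N → ℝ → ℝ)
    (hderiv : ∀ (i : Fin N) (x : ℝ), HasDerivAt (c i) (c' i x) x)
    (ϖ ι : Fin N → ℝ) (hϖ : ∀ i, 0 < ϖ i) (hι : ∀ i, 0 < ι i)
    (hconv : ∀ (i : Fin N) (x y : ℝ),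
      ϖ i * (x - y) ^ 2 ≤ (x - y) * (c' i x - c' i y))
    (hlip : ∀ (i : Fin N) (x y : ℝ), |c' i x - c' i y| ≤ ι i * |x - y|)
    (ϖ₀ : ℝ) (hϖ₀ : IsLeast (Set.range ϖ) ϖ₀)
    (ι₀ : ℝ) (hι₀ : IsGreatest (Set.range ι) ι₀)
    (lam₂ : ℝ) (hlam₂pos : 0 < lam₂)
    (hlam₂ : ∀ x : Fin N → ℝ,
      lam₂ * ∑ i, (x i - (∑ j, x j) / N) ^ 2 ≤ x ⬝ᵥ Lbar.mulVec x)
    (δ β₁ β₂ : ℝ) (hδ : 0 < δ) (hβ₁ : 0 < β₁) (hβ₂ : 0 < β₂)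
    (hcond₁ : 0 < 2 * ϖ₀ - ι₀ ^ 2 / (4 * δ))
    (hcond₂ : 0 < β₂ * ρlb - 2 * δ)
    (hcond₃ : 0 < β₁ * lam₂ - β₂ ^ 2 / δ)
    (s : ℝ) :
    ∃ k μ : ℝ, 1 ≤ k ∧ 0 < μ ∧
      ∀ ytil ztil : ℝ → Fin N → ℝ,
        (∀ t : ℝ, 0 ≤ t → ∀ i : Fin N, HasDerivAt (fun τ => ytil τ i)
          (-((ρ i)⁻¹ * (c' i (ytil t i + s) - c' i s))
            - β₁ * L.mulVec (ytil t) i - β₂ * ztil t i) t) →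
        (∀ t : ℝ, 0 ≤ t → ∀ i : Fin N, HasDerivAt (fun τ => ztil τ i)
          (β₁ * L.mulVec (ytil t) i) t) →
        (∑ i, ρ i * ztil 0 i = 0) →
        ∀ t : ℝ, 0 ≤ t →
          ∑ i, ytil t i ^ 2 + ∑ i, ztil t i ^ 2
            ≤ k * (∑ i, ytil 0 i ^ 2 + ∑ i, ztil 0 i ^ 2) * Real.exp (-μ * t) := by
  have hρle : ∀ i, ρ i ≤ 1 := fun i =>
    hρsum ▸ Finset.single_le_sum (fun j _ => (hρpos j).le) (Finset.mem_univ i)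
  have hlb : ∀ i, ρlb ≤ ρ i := fun i => hρlb.2 ⟨i, rfl⟩
  obtain ⟨i₀, hi₀⟩ := hρlb.1
  have hlbpos : 0 < ρlb := hi₀ ▸ hρpos i₀
  have hlb1 : ρlb ≤ 1 := hi₀ ▸ hρle i₀
  set p := 2 * ϖ₀ - ι₀ ^ 2 / (4 * δ)
  set q := β₂ * ρlb - 2 * δ
  refine ⟨12 / ρlb, min p q / 2, ?_, by positivity, ?_⟩
  · rw [le_div_iff₀ hlbpos]; linarith
  intro y z hy hz hz0 t ht
  have hρLx : ∀ x : Fin N → ℝ, ∑ i, ρ i * (L *ᵥ x) i = 0 := fun x => by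
    have h := dotProduct_mulVec ρ L x
    rwa [hρL, zero_dotProduct] at h
  have hzsum : ∀ t, 0 ≤ t → ∑ i, ρ i * z t i = 0 := by
    intro t ht
    have hd : ∀ τ, 0 ≤ τ → HasDerivAt (fun τ => ∑ i, ρ i * z τ i) 0 τ := fun τ hτ => by
      have h := HasDerivAt.fun_sum (u := Finset.univ)
        fun i _ => (hz τ hτ i).const_mul (ρ i)
      refine h.congr_deriv ?_
      rw [← mul_zero β₁, ← hρLx (y τ), Finset.mul_sum]
      exact Finset.sum_congr rfl fun i _ => by ring
    rw [← hz0]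
    exact constant_of_has_deriv_right_zero
      (fun τ hτ => (hd τ hτ.1).continuousAt.continuousWithinAt)
      (fun τ hτ => (hd τ hτ.1).hasDerivWithinAt) t ⟨ht, le_rfl⟩
  let V : ℝ → ℝ := fun τ => ∑ i, ρ i / 2 * (y τ i ^ 2 + (y τ i + z τ i) ^ 2)
  let D : ℝ → Fin N → ℝ := fun τ i => c' i (y τ i + s) - c' i s
  let V' : ℝ → ℝ := fun τ => ∑ i, (-2 * (y τ i * D τ i) - z τ i * D τ i
    - 2 * β₂ * (ρ i * y τ i * z τ i) - β₂ * ρ i * z τ i ^ 2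
    - β₁ * (ρ i * y τ i * (L *ᵥ y τ) i))
  have hV : ∀ τ, 0 ≤ τ → HasDerivAt V (V' τ) τ := fun τ hτ => by
    refine HasDerivAt.fun_sum fun i _ => ?_
    have h := (((hy τ hτ i).pow 2).add (((hy τ hτ i).add (hz τ hτ i)).pow 2)).const_mul (ρ i / 2)
    refine h.congr_deriv ?_
    have := (hρpos i).ne'
    simp only [D, Pi.add_apply]
    field_simp
    ring
  have hVupper : ∀ τ, V τ ≤ 2 * (∑ i, y τ i ^ 2 + ∑ i, z τ i ^ 2) := fun τ => by
    rw [← Finset.sum_add_distrib, Finset.mul_sum]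
    refine Finset.sum_le_sum fun i _ => ?_
    have h : ρ i / 2 * (y τ i ^ 2 + (y τ i + z τ i) ^ 2)
        ≤ 1 / 2 * (y τ i ^ 2 + (y τ i + z τ i) ^ 2) := by
      have := hρle i
      gcongr
    nlinarith [sq_nonneg (y τ i - z τ i), sq_nonneg (z τ i)]
  have hVlower : ∀ τ, ρlb / 6 * (∑ i, y τ i ^ 2 + ∑ i, z τ i ^ 2) ≤ V τ := fun τ => by
    rw [← Finset.sum_add_distrib, Finset.mul_sum]
    refine Finset.sum_le_sum fun i _ => ?_
    have h : ρlb / 2 * (y τ i ^ 2 + (y τ i + z τ i) ^ 2)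
        ≤ ρ i / 2 * (y τ i ^ 2 + (y τ i + z τ i) ^ 2) := by
      have := hlb i
      gcongr
    have h' : y τ i ^ 2 + z τ i ^ 2 ≤ 3 * (y τ i ^ 2 + (y τ i + z τ i) ^ 2) := by
      nlinarith [sq_nonneg (3 * y τ i + 2 * z τ i)]
    nlinarith [mul_le_mul_of_nonneg_left h' hlbpos.le]
  have hVdecay : ∀ τ, 0 ≤ τ → V' τ ≤ -(min p q / 2) * V τ := fun τ hτ => by
    set m := (∑ j, y τ j) / N with hm
    have hLy := hlam₂ (y τ)
    rw [hLbar, hR, dotProduct_symmPart_mulVec_s11, ← hm] at hLy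
    have hsplit : V' τ = (∑ i, (-2 * (y τ i * D τ i) - z τ i * D τ i
        - 2 * β₂ * (ρ i * (y τ i - m) * z τ i) - β₂ * ρ i * z τ i ^ 2))
        - β₁ * ∑ i, ρ i * y τ i * (L *ᵥ y τ) i - 2 * β₂ * m * ∑ i, ρ i * z τ i := by
      rw [Finset.mul_sum, Finset.mul_sum, ← Finset.sum_sub_distrib, ← Finset.sum_sub_distrib]
      exact Finset.sum_congr rfl fun i _ => by ring
    have hcoord : (∑ i, (-2 * (y τ i * D τ i) - z τ i * D τ i
        - 2 * β₂ * (ρ i * (y τ i - m) * z τ i) - β₂ * ρ i * z τ i ^ 2))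
        ≤ -p * ∑ i, y τ i ^ 2 - q * ∑ i, z τ i ^ 2
          + β₂ ^ 2 / δ * ∑ i, (y τ i - m) ^ 2 := by
      rw [Finset.mul_sum, Finset.mul_sum, Finset.mul_sum, ← Finset.sum_sub_distrib,
        ← Finset.sum_add_distrib]
      refine Finset.sum_le_sum fun i _ => ?_
      refine dissipation_coord_le hδ hβ₂ (hρpos i) (hρle i) (hlb i) (hϖ₀.2 ⟨i, rfl⟩)
        (hι₀.2 ⟨i, rfl⟩) ?_ ?_
      · simpa [D] using hconv i (y τ i + s) s
      · simpa [D] using hlip i (y τ i + s) s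
    have hY : 0 ≤ ∑ i, y τ i ^ 2 := Finset.sum_nonneg fun i _ => sq_nonneg _
    have hZ : 0 ≤ ∑ i, z τ i ^ 2 := Finset.sum_nonneg fun i _ => sq_nonneg _
    have hM : 0 ≤ ∑ i, (y τ i - m) ^ 2 := Finset.sum_nonneg fun i _ => sq_nonneg _
    rw [hzsum τ hτ] at hsplit
    have hmin : 0 < min p q := lt_min hcond₁ hcond₂
    have h₁ := mul_le_mul_of_nonneg_left hLy hβ₁.le
    have h₂ := mul_nonneg hcond₃.le hM
    have h₃ := mul_le_mul_of_nonneg_right (min_le_left p q) hY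
    have h₄ := mul_le_mul_of_nonneg_right (min_le_right p q) hZ
    have h₅ := mul_le_mul_of_nonneg_left (hVupper τ) hmin.le
    linarith
  have hfin := (hVlower t).trans (le_mul_exp_of_hasDerivAt_le_s11 hV hVdecay ht)
  have hexp := Real.exp_pos (-(min p q / 2) * t)
  have h₀ := mul_le_mul_of_nonneg_right (hVupper 0) hexp.le
  rw [div_mul_eq_mul_div, div_mul_eq_mul_div, le_div_iff₀ hlbpos]
  linarith
end
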